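/- Let 1 ≤ d ≤ 5, let u_1, u_2 ∈ M_d be hermitian, and assume u_1 + i·u_2 is unitarily irreducible. Then the set of points α ∈ W(u_1,u_2) such that 𝔼|_{𝓜_d} fails to be open at some state in the fiber 𝔼|_{𝓜_d}^{-1}(α) has at most max{0, d − 3} elements. -/

import Mathlib

open Set Filter Topology Matrix
open scoped ComplexOrder

/-- The joint numerical range `W(u₁,u₂) ⊆ ℝ²` of two (hermitian) matrices. -/
def jointNR {d : ℕ} (u₁ u₂ : Matrix (Fin d) (Fin d) ℂ) : Set (ℝ × ℝ) :=
  {p | ∃ x : Fin d → ℂ, star x ⬝ᵥ x = 1 ∧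
    p = ((star x ⬝ᵥ u₁.mulVec x).re, (star x ⬝ᵥ u₂.mulVec x).re)}

/-- The state space `𝓜_d`: positive semidefinite matrices of trace one. -/
def stateSpace (d : ℕ) : Set (Matrix (Fin d) (Fin d) ℂ) :=
  {ρ | ρ.PosSemidef ∧ ρ.trace = 1}

/-- The expected value map `ρ ↦ (tr(u₁ρ), tr(u₂ρ))` (real for hermitian arguments). -/
noncomputable def expVal2 {d : ℕ} (u₁ u₂ : Matrix (Fin d) (Fin d) ℂ)
    (ρ : Matrix (Fin d) (Fin d) ℂ) : ℝ × ℝ :=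
  ((u₁ * ρ).trace.re, (u₂ * ρ).trace.re)

/-- `f` restricted to `K` (viewed as a map onto `L`, both with subspace topologies) is open at
`v ∈ K` if the image of every neighborhood of `v` in `K` is a neighborhood of `f v` in `L`. -/
def MapsOpenAt {X Y : Type*} [TopologicalSpace X] [TopologicalSpace Y]
    (f : X → Y) (K : Set X) (L : Set Y) (v : X) : Prop :=
  ∀ N : Set X, N ⊆ K → N ∈ nhdsWithin v K → f '' N ∈ nhdsWithin (f v) L

/-- A supporting line of `C` at `p`: the level set of a nonzero linear functional attaining
its maximum over `C` at `p`. -/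
def IsSupportingLineAt (C : Set (ℝ × ℝ)) (p : ℝ × ℝ) (l : Set (ℝ × ℝ)) : Prop :=
  ∃ (φ : (ℝ × ℝ) →ₗ[ℝ] ℝ) (c : ℝ), φ ≠ 0 ∧ l = {q | φ q = c} ∧ φ p = c ∧ ∀ q ∈ C, φ q ≤ c

/-- A corner point of `C`: a point of `C` lying on more than one supporting line. -/
def IsCornerPoint (C : Set (ℝ × ℝ)) (p : ℝ × ℝ) : Prop :=
  p ∈ C ∧ ∃ l₁ l₂ : Set (ℝ × ℝ), l₁ ≠ l₂ ∧ IsSupportingLineAt C p l₁ ∧ IsSupportingLineAt C p l₂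

/-- A round boundary point of `C`: a boundary point which is neither a corner point nor lies
in the relative interior of a flat boundary portion (a nondegenerate segment in the boundary). -/
def IsRoundBoundaryPoint (C : Set (ℝ × ℝ)) (p : ℝ × ℝ) : Prop :=
  p ∈ frontier C ∧ ¬ IsCornerPoint C p ∧
    ¬ ∃ a b : ℝ × ℝ, a ≠ b ∧ segment ℝ a b ⊆ frontier C ∧ p ∈ openSegment ℝ a b

/-- `z` is singularly generated if all unit vectors generating it are proportional. -/
def SinglyGenerated {d : ℕ} (u₁ u₂ : Matrix (Fin d) (Fin d) ℂ) (z : ℝ × ℝ) : Prop :=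
  ∀ x y : Fin d → ℂ, star x ⬝ᵥ x = 1 → star y ⬝ᵥ y = 1 →
    ((star x ⬝ᵥ u₁.mulVec x).re, (star x ⬝ᵥ u₂.mulVec x).re) = z →
    ((star y ⬝ᵥ u₁.mulVec y).re, (star y ⬝ᵥ u₂.mulVec y).re) = z →
    ∃ c : ℂ, y = c • x

/-- `z` is multiply generated if it lies in the joint numerical range but is not
singularly generated. -/
def MultiplyGenerated {d : ℕ} (u₁ u₂ : Matrix (Fin d) (Fin d) ℂ) (z : ℝ × ℝ) : Prop :=
  z ∈ jointNR u₁ u₂ ∧ ¬ SinglyGenerated u₁ u₂ z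

/-- A matrix is unitarily reducible if it is unitarily equivalent to a block diagonal matrix
with (at least) two proper diagonal blocks. -/
def UnitarilyReducible {d : ℕ} (A : Matrix (Fin d) (Fin d) ℂ) : Prop :=
  ∃ (a b : ℕ) (hab : a + b = d), 0 < a ∧ 0 < b ∧
    ∃ U ∈ Matrix.unitaryGroup (Fin d) ℂ,
      ∃ (B : Matrix (Fin a) (Fin a) ℂ) (C : Matrix (Fin b) (Fin b) ℂ),
        star U * A * U =
          Matrix.reindex (finSumFinEquiv.trans (finCongr hab))
            (finSumFinEquiv.trans (finCongr hab)) (Matrix.fromBlocks B 0 0 C)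

/-- A simplex is the convex hull of finitely many affinely independent points. -/
def IsSimplex {Y : Type*} [AddCommGroup Y] [Module ℝ Y] (S : Set Y) : Prop :=
  ∃ s : Finset Y, AffineIndependent ℝ (fun p : (s : Set Y) => (p : Y)) ∧
    S = convexHull ℝ (s : Set Y)

/-- `w` is a simplicial point of `C` if finitely many simplices contained in `C`
cover a neighborhood of `w` in `C`. -/
def IsSimplicialPoint {Y : Type*} [AddCommGroup Y] [Module ℝ Y] [TopologicalSpace Y]
    (C : Set Y) (w : Y) : Prop :=
  ∃ (m : ℕ) (S : Fin m → Set Y),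
    (∀ i, IsSimplex (S i) ∧ S i ⊆ C) ∧ (⋃ i, S i) ∈ nhdsWithin w C

/-- A face of a convex set `C`: a convex subset `F ⊆ C` such that any segment of `C` whose
relative interior meets `F` lies in `F` (i.e. `F` is convex and extreme in `C`). -/
def IsFaceOf {Y : Type*} [AddCommGroup Y] [Module ℝ Y] (C F : Set Y) : Prop :=
  Convex ℝ F ∧ IsExtreme ℝ C F

/-- The dimension of a convex set: the dimension of its affine hull. -/
noncomputable def convDim {Y : Type*} [NormedAddCommGroup Y] [NormedSpace ℝ Y]
    (C : Set Y) : ℕ :=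
  Module.finrank ℝ (affineSpan ℝ C).direction

section PlanarConvex

theorem Convex.add_smul_add_smul_mem {F : Type*} [AddCommGroup F] [Module ℝ F] {C : Set F}
    (hC : Convex ℝ C) {x v p : F} (hx : x ∈ C) (hadd : x + v ∈ C) (hsub : x - v ∈ C) (hp : p ∈ C)
    {s t : ℝ} (ht : 0 ≤ t) (hst : |s| + t ≤ 1) : x + s • v + t • (p - x) ∈ C := by
  have key : ∀ y ∈ C, ∀ r : ℝ, 0 ≤ r → r + t ≤ 1 → (1 - r - t) • x + r • y + t • p ∈ C := by
    intro y hy r hr hrt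
    have := hC.sum_mem (t := Finset.univ) (w := ![1 - r - t, r, t]) (z := ![x, y, p])
      (by intro i _; fin_cases i <;> simp <;> linarith) (by simp [Fin.sum_univ_three]; ring)
      (by intro i _; fin_cases i <;> simp [hx, hy, hp])
    simpa [Fin.sum_univ_three] using this
  rcases le_total 0 s with hs | hs
  · rw [abs_of_nonneg hs] at hst
    convert key _ hadd s hs hst using 1
    module
  · rw [abs_of_nonpos hs] at hst
    convert key _ hsub (-s) (by linarith) hst using 1
    module

theorem Convex.eventually_smul_mem_of_half_plane {C : Set (ℝ × ℝ)} (hC : Convex ℝ C)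
    {α v : ℝ × ℝ} (hα : α ∈ C) (hv : v ≠ 0) (hadd : α + v ∈ C) (hsub : α - v ∈ C) (r : ℝ)
    (hr : 0 ≤ r) :
    ∀ᶠ q in 𝓝 α, q ∈ C → 0 ≤ v.1 * (q.2 - α.2) - v.2 * (q.1 - α.1) → α + r • (q - α) ∈ C := by
  set ψ : ℝ × ℝ → ℝ := fun q => v.1 * (q.2 - α.2) - v.2 * (q.1 - α.1) with hψ
  have hψα : ψ α = 0 := by simp [hψ]
  have hψc : Continuous ψ := by fun_prop
  obtain ⟨p, hp, hp0, hp'⟩ : ∃ p ∈ C, 0 ≤ ψ p ∧ (ψ p = 0 → ∀ q ∈ C, ψ q ≤ 0) := by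
    by_cases h : ∃ p ∈ C, 0 < ψ p
    · obtain ⟨p, hp, h⟩ := h
      exact ⟨p, hp, h.le, fun h' => absurd h' h.ne'⟩
    · push Not at h
      exact ⟨α, hα, hψα.ge, fun _ => h⟩
  have hn : v.1 ^ 2 + v.2 ^ 2 ≠ 0 := by
    intro h
    apply hv
    ext <;> simp <;> nlinarith [sq_nonneg v.1, sq_nonneg v.2]
  set t : ℝ × ℝ → ℝ := fun q => ψ q / ψ p with ht
  set s : ℝ × ℝ → ℝ := fun q => ((q.1 - α.1 - t q * (p.1 - α.1)) * v.1
    + (q.2 - α.2 - t q * (p.2 - α.2)) * v.2) / (v.1 ^ 2 + v.2 ^ 2) with hs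
  have htc : Continuous t := hψc.div_const _
  have hsc : Continuous s := by fun_prop
  have hcont : Continuous fun q => |r * s q| + r * t q := by fun_prop
  have hzero : |r * s α| + r * t α = 0 := by simp [hs, ht, hψα]
  have hev : ∀ᶠ q in 𝓝 α, |r * s q| + r * t q < 1 :=
    hcont.continuousAt.eventually_lt continuousAt_const (by rw [hzero]; exact one_pos)
  filter_upwards [hev] with q hq hqC hqψ
  have htp : t q * ψ p = ψ q := by
    by_cases h0 : ψ p = 0
    · rw [h0, mul_zero]
      exact le_antisymm hqψ (hp' h0 q hqC)
    · exact div_mul_cancel₀ _ h0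
  have hdecomp : q - α = s q • v + t q • (p - α) := by
    have hsq : s q * (v.1 ^ 2 + v.2 ^ 2) = (q.1 - α.1 - t q * (p.1 - α.1)) * v.1
        + (q.2 - α.2 - t q * (p.2 - α.2)) * v.2 := div_mul_cancel₀ _ hn
    simp only [hψ] at htp
    ext
    · simp only [Prod.fst_add, Prod.smul_fst, Prod.fst_sub, smul_eq_mul]
      apply mul_left_cancel₀ hn
      linear_combination (-v.1) * hsq + v.2 * htp
    · simp only [Prod.snd_add, Prod.smul_snd, Prod.snd_sub, smul_eq_mul]
      apply mul_left_cancel₀ hn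
      linear_combination (-v.2) * hsq - v.1 * htp
  rw [hdecomp, smul_add, smul_smul, smul_smul, ← add_assoc]
  exact hC.add_smul_add_smul_mem hα hadd hsub hp
    (mul_nonneg hr (div_nonneg hqψ hp0)) hq.le

/-- Near a point which is not extreme, a planar convex set is stable under homotheties centered
at this point. -/
theorem Convex.eventually_smul_mem_of_notMem_extremePoints {C : Set (ℝ × ℝ)} (hC : Convex ℝ C)
    {α : ℝ × ℝ} (hα : α ∈ C) (hext : α ∉ C.extremePoints ℝ) {r : ℝ} (hr : 0 ≤ r) :
    ∀ᶠ q in 𝓝[C] α, α + r • (q - α) ∈ C := by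
  obtain ⟨v, hv, hadd, hsub⟩ : ∃ v ≠ 0, α + v ∈ C ∧ α - v ∈ C := by
    simp only [mem_extremePoints_iff_left, hα, true_and] at hext
    push Not at hext
    obtain ⟨x, hx, y, hy, ⟨a, b, ha, hb, hab, rfl⟩, hne⟩ := hext
    have hxy : x - y ≠ 0 := by
      intro h
      rw [sub_eq_zero] at h
      apply hne
      rw [← h, ← add_smul, hab, one_smul]
    refine ⟨(a * b) • (x - y), smul_ne_zero (mul_pos ha hb).ne' hxy, ?_, ?_⟩
    · have e : a • x + b • y + (a * b) • (x - y) = (a + a * b) • x + (b - a * b) • y := by module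
      rw [e]
      exact hC hx hy (by positivity) (by nlinarith) (by linarith)
    · have e : a • x + b • y - (a * b) • (x - y) = (a - a * b) • x + (b + a * b) • y := by module
      rw [e]
      exact hC hx hy (by nlinarith) (by positivity) (by linarith)
  have h1 := hC.eventually_smul_mem_of_half_plane hα hv hadd hsub r hr
  have h2 := hC.eventually_smul_mem_of_half_plane hα (neg_ne_zero.mpr hv)
    (by rwa [← sub_eq_add_neg]) (by rwa [sub_neg_eq_add]) r hr
  filter_upwards [nhdsWithin_le_nhds h1, nhdsWithin_le_nhds h2, self_mem_nhdsWithin] with q q1 q2 hq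
  rcases le_total 0 (v.1 * (q.2 - α.2) - v.2 * (q.1 - α.1)) with h | h
  · exact q1 hq h
  · exact q2 hq (by simp only [Prod.fst_neg, Prod.snd_neg]; linarith)

/-- An extreme point of a planar convex set lies on a supporting line. -/
theorem Convex.exists_support_of_mem_extremePoints {C : Set (ℝ × ℝ)} (hC : Convex ℝ C)
    {α : ℝ × ℝ} (hα : α ∈ C.extremePoints ℝ) :
    ∃ a b : ℝ, (a ≠ 0 ∨ b ≠ 0) ∧ ∀ q ∈ C, a * q.1 + b * q.2 ≤ a * α.1 + b * α.2 := by
  obtain ⟨φ, hφ, hle⟩ : ∃ φ : (ℝ × ℝ) →ₗ[ℝ] ℝ, φ ≠ 0 ∧ ∀ q ∈ C, φ q ≤ φ α := by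
    by_cases hne : (interior C).Nonempty
    · obtain ⟨f, hf⟩ := geometric_hahn_banach_open_point hC.interior isOpen_interior
        (fun h => (disjoint_interior_extremePoints C).le_bot ⟨h, hα⟩)
      refine ⟨f, ?_, ?_⟩
      · obtain ⟨p, hp⟩ := hne
        intro h0
        have := hf p hp
        have h1 : ∀ x, f x = 0 := fun x => LinearMap.congr_fun h0 x
        rw [h1, h1] at this
        exact this.false
      · intro q hq
        have hsub : closure (interior C) ⊆ {q | f q ≤ f α} :=
          closure_minimal (fun p hp => (hf p hp).le) (isClosed_le f.continuous continuous_const)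
        rw [hC.closure_interior_eq_closure_of_nonempty_interior hne] at hsub
        exact hsub (subset_closure hq)
    · rw [hC.interior_nonempty_iff_affineSpan_eq_top] at hne
      have hαS : α ∈ affineSpan ℝ C := subset_affineSpan ℝ C (extremePoints_subset hα)
      have hdir : (affineSpan ℝ C).direction < ⊤ := by
        rw [lt_top_iff_ne_top]
        intro h
        exact hne ((AffineSubspace.direction_eq_top_iff_of_nonempty ⟨α, hαS⟩).mp h)
      obtain ⟨f, hf0, hf⟩ := Submodule.exists_le_ker_of_lt_top _ hdir
      refine ⟨f, hf0, fun q hq => le_of_eq ?_⟩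
      have := hf (AffineSubspace.vsub_mem_direction (subset_affineSpan ℝ C hq) hαS)
      rw [LinearMap.mem_ker, vsub_eq_sub, map_sub, sub_eq_zero] at this
      exact this
  have happ : ∀ q : ℝ × ℝ, φ q = φ (1, 0) * q.1 + φ (0, 1) * q.2 := by
    intro q
    have : q = q.1 • ((1, 0) : ℝ × ℝ) + q.2 • ((0, 1) : ℝ × ℝ) := by ext <;> simp
    conv_lhs => rw [this]
    rw [map_add, map_smul, map_smul, smul_eq_mul, smul_eq_mul, mul_comm, mul_comm q.2]
  refine ⟨φ (1, 0), φ (0, 1), ?_, fun q hq => by rw [← happ, ← happ]; exact hle q hq⟩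
  by_contra! h
  exact hφ (LinearMap.ext fun q => by rw [happ, h.1, h.2]; simp)

end PlanarConvex

section AbstractForms

variable {E : Type*} [NormedAddCommGroup E] [InnerProductSpace ℂ E]

local notation "⟪" x "," y "⟫" => @inner ℂ _ InnerProductSpace.toInner x y

/-- If a symmetric operator is nonnegative on the complex line through `x` in direction `y` and
its quadratic form vanishes at `x`, then the associated sesquilinear form vanishes at `(x, y)`. -/
theorem LinearMap.IsSymmetric.inner_eq_zero_of_nonneg_line {S : E →ₗ[ℂ] E} (hS : S.IsSymmetric)
    {x y : E} (h : ∀ t : ℂ, 0 ≤ (⟪x + t • y, S (x + t • y)⟫).re) (hx : (⟪x, S x⟫).re = 0) :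
    ⟪x, S y⟫ = 0 := by
  set w := ⟪x, S y⟫ with hw
  have hyx : ⟪y, S x⟫ = (starRingEnd ℂ) w := by
    rw [hw, ← hS y x]; exact (inner_conj_symm _ _).symm
  have key : ∀ ε : ℝ, 0 ≤ -2 * ε * Complex.normSq w + ε ^ 2 * Complex.normSq w * (⟪y, S y⟫).re := by
    intro ε
    have := h (-(ε : ℂ) * (starRingEnd ℂ) w)
    simp only [map_add, map_smul, inner_add_left, inner_add_right, inner_smul_left,
      inner_smul_right, hyx, ← hw] at this
    simp [hx, Complex.mul_re, Complex.mul_im, Complex.normSq_apply] at this ⊢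
    nlinarith
  by_contra hne
  have hpos : 0 < Complex.normSq w := Complex.normSq_pos.mpr hne
  set B := (⟪y, S y⟫).re
  have h1 := key (1 / (1 + |B|))
  have hB : 0 < 1 + |B| := by positivity
  have hB' := le_abs_self B
  have h2 : -2 * (1 / (1 + |B|)) * Complex.normSq w + (1 / (1 + |B|)) ^ 2 * Complex.normSq w * B
      = Complex.normSq w * (-2 * (1 + |B|) + B) / (1 + |B|) ^ 2 := by
    field_simp
  rw [h2] at h1
  have h3 : Complex.normSq w * (-2 * (1 + |B|) + B) < 0 :=
    mul_neg_of_pos_of_neg hpos (by linarith [abs_nonneg B])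
  have := div_neg_of_neg_of_pos h3 (by positivity : 0 < (1 + |B|) ^ 2)
  linarith

/-- The inner product and the two sesquilinear forms of `T₁`, `T₂`, taken together. -/
noncomputable def jointForm (T₁ T₂ : E →ₗ[ℂ] E) (x y : E) : ℂ × ℂ × ℂ :=
  (⟪x, y⟫, ⟪x, T₁ y⟫, ⟪x, T₂ y⟫)

/-- The pair of quadratic forms of `T₁`, `T₂`. -/
noncomputable def quadVal (T₁ T₂ : E →ₗ[ℂ] E) (x : E) : ℝ × ℝ :=
  ((⟪x, T₁ x⟫).re, (⟪x, T₂ x⟫).re)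

/-- `α` cannot be written as a proper convex combination of two values of the quadratic forms. -/
def IsExtremeValue (T₁ T₂ : E →ₗ[ℂ] E) (α : ℝ × ℝ) : Prop :=
  ∀ x y, quadVal T₁ T₂ x + quadVal T₁ T₂ y = (‖x‖ ^ 2 + ‖y‖ ^ 2) • α →
    quadVal T₁ T₂ x = ‖x‖ ^ 2 • α

/-- The line through `α` with normal `(a, b)` is an eigenline for the vectors generating `α`. -/
def HasSupport (T₁ T₂ : E →ₗ[ℂ] E) (α : ℝ × ℝ) (a b : ℝ) : Prop :=
  (a ≠ 0 ∨ b ≠ 0) ∧ ∀ x, quadVal T₁ T₂ x = ‖x‖ ^ 2 • α →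
    (a : ℂ) • T₁ x + (b : ℂ) • T₂ x = ((a * α.1 + b * α.2 : ℝ) : ℂ) • x

variable {T₁ T₂ : E →ₗ[ℂ] E} {α β γ : ℝ × ℝ}

theorem jointForm_add_right (x y z : E) :
    jointForm T₁ T₂ x (y + z) = jointForm T₁ T₂ x y + jointForm T₁ T₂ x z := by
  simp [jointForm, inner_add_right]

theorem jointForm_add_left (x y z : E) :
    jointForm T₁ T₂ (x + y) z = jointForm T₁ T₂ x z + jointForm T₁ T₂ y z := by
  simp [jointForm, inner_add_left]

theorem jointForm_sub_right (x y z : E) :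
    jointForm T₁ T₂ x (y - z) = jointForm T₁ T₂ x y - jointForm T₁ T₂ x z := by
  simp [jointForm, inner_sub_right]

theorem jointForm_smul_right (c : ℂ) (x y : E) :
    jointForm T₁ T₂ x (c • y) = c • jointForm T₁ T₂ x y := by
  simp [jointForm, inner_smul_right]

theorem jointForm_smul_left (c : ℂ) (x y : E) :
    jointForm T₁ T₂ (c • x) y = (starRingEnd ℂ) c • jointForm T₁ T₂ x y := by
  simp [jointForm, inner_smul_left]

theorem jointForm_eq_zero_symm (h₁ : T₁.IsSymmetric) (h₂ : T₂.IsSymmetric) {x y : E}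
    (h : jointForm T₁ T₂ x y = 0) : jointForm T₁ T₂ y x = 0 := by
  simp only [jointForm, Prod.mk_eq_zero] at h ⊢
  refine ⟨inner_eq_zero_symm.mp h.1, ?_, ?_⟩
  · rw [← h₁]; exact inner_eq_zero_symm.mp h.2.1
  · rw [← h₂]; exact inner_eq_zero_symm.mp h.2.2

theorem quadVal_smul (c : ℂ) (x : E) :
    quadVal T₁ T₂ (c • x) = ‖c‖ ^ 2 • quadVal T₁ T₂ x := by
  have : ∀ w : ℂ, (c * ((starRingEnd ℂ) c * w)).re = ‖c‖ ^ 2 * w.re := by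
    intro w
    rw [← mul_assoc, mul_comm c, ← Complex.normSq_eq_conj_mul_self, Complex.re_ofReal_mul,
      Complex.normSq_eq_norm_sq]
  simp only [quadVal, map_smul, inner_smul_left, inner_smul_right, this]
  rfl

theorem norm_smul_sq (c : ℂ) (x : E) : ‖c • x‖ ^ 2 = ‖c‖ ^ 2 * ‖x‖ ^ 2 := by
  rw [norm_smul, mul_pow]

theorem quadVal_parallelogram (x y : E) :
    quadVal T₁ T₂ (x + y) + quadVal T₁ T₂ (x - y)
      = (2 : ℝ) • (quadVal T₁ T₂ x + quadVal T₁ T₂ y) := by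
  simp only [quadVal, map_add, map_sub, inner_add_left, inner_add_right, inner_sub_left,
    inner_sub_right, Prod.mk_add_mk, Prod.smul_mk, Complex.add_re, Complex.sub_re, smul_eq_mul,
    Prod.mk.injEq]
  constructor <;> ring

/-- The subspace of the vectors generating an extreme value. -/
def genSubspace (hα : IsExtremeValue T₁ T₂ α) : Submodule ℂ E where
  carrier := {x | quadVal T₁ T₂ x = ‖x‖ ^ 2 • α}
  zero_mem' := by simp [quadVal]
  add_mem' := by
    intro x y hx hy
    apply hα (x + y) (x - y)
    have := parallelogram_law_with_norm ℂ x y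
    rw [quadVal_parallelogram, show quadVal T₁ T₂ x = _ from hx,
      show quadVal T₁ T₂ y = _ from hy, ← add_smul, smul_smul]
    congr 1
    linarith
  smul_mem' := by
    intro c x hx
    change quadVal T₁ T₂ (c • x) = _
    rw [quadVal_smul, show quadVal T₁ T₂ x = _ from hx, norm_smul_sq, smul_smul]

theorem mem_genSubspace {hα : IsExtremeValue T₁ T₂ α} {x : E} :
    x ∈ genSubspace hα ↔ quadVal T₁ T₂ x = ‖x‖ ^ 2 • α := Iff.rfl

theorem disjoint_genSubspace (hα : IsExtremeValue T₁ T₂ α) (hβ : IsExtremeValue T₁ T₂ β)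
    (hne : α ≠ β) : Disjoint (genSubspace hα) (genSubspace hβ) := by
  rw [Submodule.disjoint_def]
  intro x hx hy
  by_contra h0
  have : ‖x‖ ^ 2 • α = ‖x‖ ^ 2 • β := by
    rw [← mem_genSubspace.mp hx, mem_genSubspace.mp hy]
  exact hne (smul_right_injective _ (pow_ne_zero 2 (norm_ne_zero_iff.mpr h0)) this)

theorem IsExtremeValue.mem_of_add_mem (h₁ : T₁.IsSymmetric) (h₂ : T₂.IsSymmetric)
    (hα : IsExtremeValue T₁ T₂ α) {x y : E} (hxy : jointForm T₁ T₂ x y = 0)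
    (h : x + y ∈ genSubspace hα) : x ∈ genSubspace hα := by
  apply hα x y
  have hyx := jointForm_eq_zero_symm h₁ h₂ hxy
  simp only [jointForm, Prod.mk_eq_zero] at hxy hyx
  have hn : ‖x + y‖ ^ 2 = ‖x‖ ^ 2 + ‖y‖ ^ 2 := by
    have := norm_add_sq_eq_norm_sq_add_norm_sq_of_inner_eq_zero x y hxy.1
    nlinarith
  rw [← hn, ← mem_genSubspace.mp h]
  simp [quadVal, inner_add_left, inner_add_right, hxy, hyx]

theorem exists_mem_norm_sq_eq (L : Submodule ℂ E) {x : E} (hx : x ∈ L) (hx0 : x ≠ 0) {r : ℝ}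
    (hr : 0 ≤ r) : ∃ x' ∈ L, ‖x'‖ ^ 2 = r := by
  refine ⟨((Real.sqrt r / ‖x‖ : ℝ) : ℂ) • x, L.smul_mem _ hx, ?_⟩
  have : ‖x‖ ≠ 0 := norm_ne_zero_iff.mpr hx0
  rw [norm_smul_sq, Complex.norm_real, Real.norm_eq_abs, sq_abs, div_pow, Real.sq_sqrt hr]
  field_simp

/-- A point strictly between two distinct values is not extreme. -/
theorem IsExtremeValue.eq_of_between (hα : IsExtremeValue T₁ T₂ α) (hβ : IsExtremeValue T₁ T₂ β)
    (hγ : IsExtremeValue T₁ T₂ γ) {x y : E} (hx : x ∈ genSubspace hα) (hy : y ∈ genSubspace hβ)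
    (hx0 : x ≠ 0) (hy0 : y ≠ 0) {p q : ℝ} (hp : 0 < p) (hq : 0 < q)
    (h : p • α + q • β = (p + q) • γ) : α = γ := by
  obtain ⟨x', hx', hxp⟩ := exists_mem_norm_sq_eq _ hx hx0 hp.le
  obtain ⟨y', hy', hyq⟩ := exists_mem_norm_sq_eq _ hy hy0 hq.le
  rw [mem_genSubspace, hxp] at hx'
  rw [mem_genSubspace, hyq] at hy'
  have := hγ x' y' (by rw [hx', hy', h, hxp, hyq])
  rw [hx', hxp] at this
  exact smul_right_injective _ hp.ne' this

theorem IsExtremeValue.not_collinear (hα : IsExtremeValue T₁ T₂ α) (hβ : IsExtremeValue T₁ T₂ β)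
    (hγ : IsExtremeValue T₁ T₂ γ) {x y z : E} (hx : x ∈ genSubspace hα)
    (hy : y ∈ genSubspace hβ) (hz : z ∈ genSubspace hγ) (hx0 : x ≠ 0) (hy0 : y ≠ 0) (hz0 : z ≠ 0)
    (hαβ : α ≠ β) (hαγ : α ≠ γ) (hβγ : β ≠ γ) {s : ℝ} (h : γ = α + s • (β - α)) : False := by
  have h1 : γ.1 = α.1 + s * (β.1 - α.1) := by rw [h]; rfl
  have h2 : γ.2 = α.2 + s * (β.2 - α.2) := by rw [h]; rfl
  rcases lt_trichotomy s 0 with hs | hs | hs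
  · refine hβ.eq_of_between hγ hα hy hz hy0 hz0 (p := -s) (q := 1) (by linarith) one_pos ?_ |>
      fun h => hαβ h.symm
    ext <;> simp [h1, h2] <;> ring
  · exact hαγ (by simp [h, hs])
  rcases lt_trichotomy s 1 with hs' | hs' | hs'
  · refine hαγ (hα.eq_of_between hβ hγ hx hy hx0 hy0 (p := 1 - s) (q := s) (by linarith) hs ?_)
    ext <;> simp [h1, h2] <;> ring
  · exact hβγ (by rw [h, hs']; simp)
  · refine hαβ (hα.eq_of_between hγ hβ hx hz hx0 hz0 (p := s - 1) (q := 1) (by linarith)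
      one_pos ?_)
    ext <;> simp [h1, h2] <;> ring

theorem isSymmetric_sub_real_smul {S R : E →ₗ[ℂ] E} (hS : S.IsSymmetric) (hR : R.IsSymmetric)
    (c : ℝ) : (S - (c : ℂ) • R).IsSymmetric :=
  hS.sub (hR.smul (by simp))

theorem jointForm_of_mem (h₁ : T₁.IsSymmetric) (h₂ : T₂.IsSymmetric)
    (hα : IsExtremeValue T₁ T₂ α) {x y : E} (hx : x ∈ genSubspace hα)
    (hy : y ∈ genSubspace hα) :
    jointForm T₁ T₂ x y = ⟪x, y⟫ • ((1, (α.1 : ℂ), (α.2 : ℂ)) : ℂ × ℂ × ℂ) := by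
  have aux : ∀ (S : E →ₗ[ℂ] E) (c : ℝ), S.IsSymmetric →
      (∀ v ∈ genSubspace hα, (⟪v, S v⟫).re = ‖v‖ ^ 2 * c) → ⟪x, S y⟫ = ⟪x, y⟫ * c := by
    intro S c hS h
    have hsym := isSymmetric_sub_real_smul hS LinearMap.IsSymmetric.id c
    have hz : ∀ v ∈ genSubspace hα, (⟪v, (S - (c : ℂ) • (LinearMap.id : E →ₗ[ℂ] E)) v⟫).re = 0 := by
      intro v hv
      have h2 : (⟪v, v⟫).re = ‖v‖ ^ 2 := by rw [inner_self_eq_norm_sq_to_K]; norm_cast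
      simp only [LinearMap.sub_apply, LinearMap.smul_apply, LinearMap.id_apply, inner_sub_right,
        inner_smul_right, Complex.sub_re, Complex.re_ofReal_mul, h v hv, h2]
      ring
    have := hsym.inner_eq_zero_of_nonneg_line (x := x) (y := y)
      (fun t => (hz _ (add_mem hx (Submodule.smul_mem _ t hy))).ge) (hz x hx)
    simp only [LinearMap.sub_apply, LinearMap.smul_apply, LinearMap.id_apply, inner_sub_right,
        inner_smul_right, sub_eq_zero] at this
    rw [this, mul_comm]
  have h1 := aux T₁ α.1 h₁ (fun v hv => congrArg Prod.fst (mem_genSubspace.mp hv))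
  have h2 := aux T₂ α.2 h₂ (fun v hv => congrArg Prod.snd (mem_genSubspace.mp hv))
  simp [jointForm, h1, h2]

theorem HasSupport.inner_left {a b : ℝ} (hs : HasSupport T₁ T₂ α a b)
    (hα : IsExtremeValue T₁ T₂ α) {x : E} (hx : x ∈ genSubspace hα) (y : E) :
    (a : ℂ) * ⟪y, T₁ x⟫ + b * ⟪y, T₂ x⟫ = ((a * α.1 + b * α.2 : ℝ) : ℂ) * ⟪y, x⟫ := by
  have := congrArg (fun v => ⟪y, v⟫) (hs.2 x hx)
  simpa only [inner_add_right, inner_smul_right] using this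

theorem HasSupport.inner_right (h₁ : T₁.IsSymmetric) (h₂ : T₂.IsSymmetric) {a b : ℝ}
    (hs : HasSupport T₁ T₂ α a b)
    (hα : IsExtremeValue T₁ T₂ α) {x : E} (hx : x ∈ genSubspace hα) (y : E) :
    (a : ℂ) * ⟪x, T₁ y⟫ + b * ⟪x, T₂ y⟫ = ((a * α.1 + b * α.2 : ℝ) : ℂ) * ⟪x, y⟫ := by
  have := congrArg (fun v => ⟪v, y⟫) (hs.2 x hx)
  simpa only [inner_add_left, inner_smul_left, Complex.conj_ofReal, h₁ x y, h₂ x y] using this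

theorem HasSupport.of_det_eq_zero {a b a' b' : ℝ} (hab : a ≠ 0 ∨ b ≠ 0)
    (hs : HasSupport T₁ T₂ α a' b') (hdet : a * b' - a' * b = 0) : HasSupport T₁ T₂ α a b := by
  refine ⟨hab, fun x hx => ?_⟩
  obtain ⟨m, hm, hma, hmb⟩ : ∃ m : ℝ, m ≠ 0 ∧ a' = m * a ∧ b' = m * b := by
    rcases hab with ha | hb
    · refine ⟨a' / a, ?_, by field_simp, by field_simp; linarith⟩
      intro h0
      have ha' : a' = 0 := by simpa [ha] using h0
      have hb' : b' = 0 := by simpa [ha', ha] using hdet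
      simpa [ha', hb'] using hs.1
    · refine ⟨b' / b, ?_, by field_simp; linarith, by field_simp⟩
      intro h0
      have hb' : b' = 0 := by simpa [hb] using h0
      have ha' : a' = 0 := by simpa [hb', hb] using hdet
      simpa [ha', hb'] using hs.1
  have h := hs.2 x hx
  have hmC : (m : ℂ) ≠ 0 := by exact_mod_cast hm
  apply smul_right_injective E hmC
  simp only [hma, hmb] at h
  push_cast at h ⊢
  simp only [smul_add, smul_smul]
  rw [h]
  congr 1
  ring

theorem quadVal_line_nonneg (hα : IsExtremeValue T₁ T₂ α) (hβ : IsExtremeValue T₁ T₂ β)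
    (hne : α ≠ β) {y z : E} (hy : y ∈ genSubspace hβ) (hy0 : y ≠ 0) {s : ℝ}
    (hz : quadVal T₁ T₂ z = ‖z‖ ^ 2 • α + s • (β - α)) : 0 ≤ s := by
  by_contra! hs
  obtain ⟨y', hy', hn⟩ := exists_mem_norm_sq_eq _ hy hy0 (r := -s) (by linarith)
  rw [mem_genSubspace, hn] at hy'
  have := hα z y' (by rw [hz, hy', hn]; module)
  rw [hz] at this
  have h0 : s • (β - α) = 0 := by simpa using this
  rcases smul_eq_zero.mp h0 with h | h
  · exact hs.ne h
  · exact hne (sub_eq_zero.mp h).symm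

/-- Two extreme values on a common supporting line: half of the orthogonality relations. -/
theorem inner_direction_eq (h₁ : T₁.IsSymmetric) (h₂ : T₂.IsSymmetric)
    (hα : IsExtremeValue T₁ T₂ α) (hβ : IsExtremeValue T₁ T₂ β)
    (hne : α ≠ β) {a b : ℝ} (hsα : HasSupport T₁ T₂ α a b) (hsβ : HasSupport T₁ T₂ β a b)
    (hline : a * α.1 + b * α.2 = a * β.1 + b * β.2) {x y : E}
    (hx : x ∈ genSubspace hα) (hy : y ∈ genSubspace hβ) (hy0 : y ≠ 0) :
    ((β.1 - α.1 : ℝ) : ℂ) * ⟪x, T₁ y⟫ + ((β.2 - α.2 : ℝ) : ℂ) * ⟪x, T₂ y⟫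
      = (((β.1 - α.1) * α.1 + (β.2 - α.2) * α.2 : ℝ) : ℂ) * ⟪x, y⟫ := by
  set δ₁ := β.1 - α.1 with hδ₁
  set δ₂ := β.2 - α.2 with hδ₂
  set c := δ₁ * α.1 + δ₂ * α.2 with hc
  set N : E →ₗ[ℂ] E := (δ₁ : ℂ) • T₁ + (δ₂ : ℂ) • T₂ - (c : ℂ) • LinearMap.id with hN
  have hNs : N.IsSymmetric :=
    isSymmetric_sub_real_smul ((h₁.smul (by simp)).add (h₂.smul (by simp)))
      LinearMap.IsSymmetric.id c
  have hδ : δ₁ ^ 2 + δ₂ ^ 2 ≠ 0 := by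
    intro h
    have h1 : δ₁ = 0 := by nlinarith [sq_nonneg δ₁, sq_nonneg δ₂]
    have h2 : δ₂ = 0 := by nlinarith [sq_nonneg δ₁, sq_nonneg δ₂]
    exact hne (Prod.ext (by linarith) (by linarith))
  have hNre : ∀ z : E, (⟪z, N z⟫).re =
      δ₁ * (quadVal T₁ T₂ z).1 + δ₂ * (quadVal T₁ T₂ z).2 - c * ‖z‖ ^ 2 := by
    intro z
    have h2 : (⟪z, z⟫).re = ‖z‖ ^ 2 := by rw [inner_self_eq_norm_sq_to_K]; norm_cast
    simp only [hN, LinearMap.sub_apply, LinearMap.add_apply, LinearMap.smul_apply,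
      LinearMap.id_apply, inner_sub_right, inner_add_right, inner_smul_right, Complex.sub_re,
      Complex.add_re, Complex.re_ofReal_mul, h2, quadVal]
  have hNx : (⟪x, N x⟫).re = 0 := by
    rw [hNre, mem_genSubspace.mp hx, hc]
    simp only [Prod.smul_fst, Prod.smul_snd, smul_eq_mul]
    ring
  have hker : ∀ z : E, (a : ℂ) • T₁ z + (b : ℂ) • T₂ z = ((a * α.1 + b * α.2 : ℝ) : ℂ) • z →
      0 ≤ (⟪z, N z⟫).re := by
    intro z hz
    have hz' := congrArg (fun v => (⟪z, v⟫).re) hz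
    have h2 : (⟪z, z⟫).re = ‖z‖ ^ 2 := by rw [inner_self_eq_norm_sq_to_K]; norm_cast
    simp only [inner_add_right, inner_smul_right, Complex.add_re, Complex.re_ofReal_mul, h2] at hz'
    set p := (⟪z, T₁ z⟫).re with hp
    set q := (⟪z, T₂ z⟫).re with hq
    have hab : a ^ 2 + b ^ 2 ≠ 0 := by
      intro h
      have h1 : a = 0 := by nlinarith [sq_nonneg a, sq_nonneg b]
      have h2 : b = 0 := by nlinarith [sq_nonneg a, sq_nonneg b]
      rcases hsα.1 with h | h <;> contradiction
    have horth : a * δ₁ + b * δ₂ = 0 := by rw [hδ₁, hδ₂]; linarith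
    have hpar : (p - ‖z‖ ^ 2 * α.1) * δ₂ = (q - ‖z‖ ^ 2 * α.2) * δ₁ := by
      apply mul_left_cancel₀ hab
      have e1 : a * (p - ‖z‖ ^ 2 * α.1) + b * (q - ‖z‖ ^ 2 * α.2) = 0 := by linarith
      linear_combination (a * δ₂ - b * δ₁) * e1 -
        (a * (q - ‖z‖ ^ 2 * α.2) - b * (p - ‖z‖ ^ 2 * α.1)) * horth
    have hs := quadVal_line_nonneg (T₁ := T₁) (T₂ := T₂) hα hβ hne hy hy0 (z := z)
      (s := ((p - ‖z‖ ^ 2 * α.1) * δ₁ + (q - ‖z‖ ^ 2 * α.2) * δ₂) / (δ₁ ^ 2 + δ₂ ^ 2)) (by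
        ext
        · simp only [quadVal, ← hp, Prod.fst_add, Prod.smul_fst, Prod.fst_sub, ← hδ₁, smul_eq_mul]
          field_simp
          linear_combination δ₂ * hpar
        · simp only [quadVal, ← hq, Prod.snd_add, Prod.smul_snd, Prod.snd_sub, ← hδ₂, smul_eq_mul]
          field_simp
          linear_combination -δ₁ * hpar)
    have hpos : 0 < δ₁ ^ 2 + δ₂ ^ 2 := lt_of_le_of_ne (by positivity) hδ.symm
    have := mul_nonneg hs hpos.le
    rw [div_mul_cancel₀ _ hδ] at this
    rw [hNre]
    simp only [quadVal, ← hp, ← hq, hc]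
    linarith
  have h0 := hNs.inner_eq_zero_of_nonneg_line (x := x) (y := y) (fun t => hker _ (by
    have e1 := hsα.2 x hx
    have e2 := hsβ.2 y hy
    rw [← hline] at e2
    simp only [map_add, map_smul, smul_add, smul_comm _ t, ← e1]
    rw [← e2]
    module)) hNx
  simpa only [hN, LinearMap.sub_apply, LinearMap.add_apply, LinearMap.smul_apply,
      LinearMap.id_apply, inner_sub_right, inner_add_right, inner_smul_right, sub_eq_zero] using h0

/-- Vectors generating two distinct extreme values on a common supporting line are orthogonal
with respect to all three forms. -/
theorem jointForm_eq_zero_of_common_support (h₁ : T₁.IsSymmetric) (h₂ : T₂.IsSymmetric)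
    (hα : IsExtremeValue T₁ T₂ α) (hβ : IsExtremeValue T₁ T₂ β)
    (hne : α ≠ β) {a b : ℝ} (hsα : HasSupport T₁ T₂ α a b) (hsβ : HasSupport T₁ T₂ β a b)
    (hline : a * α.1 + b * α.2 = a * β.1 + b * β.2) {x y : E}
    (hx : x ∈ genSubspace hα) (hy : y ∈ genSubspace hβ) : jointForm T₁ T₂ x y = 0 := by
  by_cases hx0 : x = 0
  · simp [jointForm, hx0]
  by_cases hy0 : y = 0
  · simp [jointForm, hy0]
  have e1 := inner_direction_eq h₁ h₂ hα hβ hne hsα hsβ hline hx hy hy0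
  have e2 := inner_direction_eq h₁ h₂ hβ hα hne.symm hsβ hsα hline.symm hy hx hx0
  have e2' := congrArg (starRingEnd ℂ) e2
  simp only [map_add, map_mul, Complex.conj_ofReal, inner_conj_symm, h₁ x y, h₂ x y] at e2'
  have e3 := hsα.inner_right h₁ h₂ hα hx y
  have hδ : (β.1 - α.1) ^ 2 + (β.2 - α.2) ^ 2 ≠ 0 := by
    intro h
    have h1 : β.1 - α.1 = 0 := by nlinarith [sq_nonneg (β.1 - α.1), sq_nonneg (β.2 - α.2)]
    have h2 : β.2 - α.2 = 0 := by nlinarith [sq_nonneg (β.1 - α.1), sq_nonneg (β.2 - α.2)]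
    exact hne (Prod.ext (by linarith) (by linarith))
  have hxy : ⟪x, y⟫ = 0 := by
    have hδC : (((β.1 - α.1) ^ 2 + (β.2 - α.2) ^ 2 : ℝ) : ℂ) ≠ 0 := by exact_mod_cast hδ
    apply (mul_eq_zero.mp (?_ : (((β.1 - α.1) ^ 2 + (β.2 - α.2) ^ 2 : ℝ) : ℂ) * ⟪x, y⟫ = 0)).resolve_left
      hδC
    push_cast at e1 e2' ⊢
    linear_combination e1 + e2'
  rw [hxy, mul_zero] at e1 e3
  have horth : (a : ℂ) * (β.1 - α.1) + b * (β.2 - α.2) = 0 := by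
    have : a * (β.1 - α.1) + b * (β.2 - α.2) = 0 := by linarith
    exact_mod_cast this
  have hδC : ((β.1 - α.1 : ℂ)) ^ 2 + (β.2 - α.2) ^ 2 ≠ 0 := by exact_mod_cast hδ
  push_cast at e1
  have key : ∀ w : ℂ, (a : ℂ) * w = 0 → (b : ℂ) * w = 0 → w = 0 := by
    intro w ha hb
    rcases hsα.1 with h | h
    · exact (mul_eq_zero.mp ha).resolve_left (by exact_mod_cast h)
    · exact (mul_eq_zero.mp hb).resolve_left (by exact_mod_cast h)
  set P := ⟪x, T₁ y⟫
  set Q := ⟪x, T₂ y⟫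
  set d₁ : ℂ := β.1 - α.1
  set d₂ : ℂ := β.2 - α.2
  have hP : P = 0 := by
    apply (mul_eq_zero.mp (?_ : (d₁ ^ 2 + d₂ ^ 2) * P = 0)).resolve_left hδC
    apply key
    · linear_combination d₂ * (d₂ * e3 - b * e1) + d₁ * P * horth
    · linear_combination -d₁ * (d₂ * e3 - b * e1) + d₂ * P * horth
  have hQ : Q = 0 := by
    apply (mul_eq_zero.mp (?_ : (d₁ ^ 2 + d₂ ^ 2) * Q = 0)).resolve_left hδC
    apply key
    · linear_combination d₂ * (a * e1 - d₁ * e3) + d₁ * Q * horth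
    · linear_combination -d₁ * (a * e1 - d₁ * e3) + d₂ * Q * horth
  simp [jointForm, hxy, P, Q, hP, hQ]

/-- The forms between the generating subspaces of two extreme values span at most a line. -/
theorem exists_jointForm_eq_smul (h₁ : T₁.IsSymmetric) (h₂ : T₂.IsSymmetric)
    (hα : IsExtremeValue T₁ T₂ α) (hβ : IsExtremeValue T₁ T₂ β)
    (hne : α ≠ β) {a b a' b' : ℝ} (hsα : HasSupport T₁ T₂ α a b) (hsβ : HasSupport T₁ T₂ β a' b') :
    ∃ v : ℂ × ℂ × ℂ, ∀ x ∈ genSubspace hα, ∀ y ∈ genSubspace hβ,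
      ∃ k : ℂ, jointForm T₁ T₂ x y = k • v := by
  by_cases hdet : a * b' - a' * b = 0
  · have hsβ' := hsβ.of_det_eq_zero hsα.1 hdet
    by_cases hline : a * α.1 + b * α.2 = a * β.1 + b * β.2
    · refine ⟨0, fun x hx y hy => ⟨0, ?_⟩⟩
      rw [jointForm_eq_zero_of_common_support h₁ h₂ hα hβ hne hsα hsβ' hline hx hy, smul_zero]
    · refine ⟨(0, -b, a), fun x hx y hy => ?_⟩
      have e1 := hsα.inner_right h₁ h₂ hα hx y
      have e2 := hsβ'.inner_left hβ hy x
      have hxy : ⟪x, y⟫ = 0 := by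
        have h0 : ((a * α.1 + b * α.2 : ℝ) : ℂ) - ((a * β.1 + b * β.2 : ℝ) : ℂ) ≠ 0 := by
          rw [sub_ne_zero]; exact_mod_cast hline
        apply (mul_eq_zero.mp (?_ : (((a * α.1 + b * α.2 : ℝ) : ℂ) -
          ((a * β.1 + b * β.2 : ℝ) : ℂ)) * ⟪x, y⟫ = 0)).resolve_left h0
        linear_combination e2 - e1
      rw [hxy, mul_zero] at e1
      have hab : (a : ℂ) ^ 2 + (b : ℂ) ^ 2 ≠ 0 := by
        have : a ^ 2 + b ^ 2 ≠ 0 := by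
          intro h
          have h1 : a = 0 := by nlinarith [sq_nonneg a, sq_nonneg b]
          have h2 : b = 0 := by nlinarith [sq_nonneg a, sq_nonneg b]
          rcases hsα.1 with h | h <;> contradiction
        exact_mod_cast this
      refine ⟨(a * ⟪x, T₂ y⟫ - b * ⟪x, T₁ y⟫) / ((a : ℂ) ^ 2 + (b : ℂ) ^ 2), ?_⟩
      simp only [jointForm, Prod.smul_mk, smul_eq_mul, hxy, Prod.mk.injEq]
      refine ⟨by simp, ?_, ?_⟩
      · field_simp
        linear_combination a * e1
      · field_simp
        linear_combination b * e1
  · set D : ℂ := a * b' - a' * b with hD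
    have hD0 : D ≠ 0 := by rw [hD]; exact_mod_cast hdet
    set c : ℂ := ((a * α.1 + b * α.2 : ℝ) : ℂ)
    set c' : ℂ := ((a' * β.1 + b' * β.2 : ℝ) : ℂ)
    refine ⟨(1, (c * b' - c' * b) / D, (a * c' - a' * c) / D), fun x hx y hy => ⟨⟪x, y⟫, ?_⟩⟩
    have e1 := hsα.inner_right h₁ h₂ hα hx y
    have e2 := hsβ.inner_left hβ hy x
    simp only [jointForm, Prod.smul_mk, smul_eq_mul, mul_one, Prod.mk.injEq, true_and]
    constructor
    · field_simp
      linear_combination b' * e1 - b * e2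
    · field_simp
      linear_combination a * e2 - a' * e1

theorem exists_jointForm_eq_smul_of_ne_zero (h₁ : T₁.IsSymmetric) (h₂ : T₂.IsSymmetric)
    (hα : IsExtremeValue T₁ T₂ α) (hβ : IsExtremeValue T₁ T₂ β)
    (hne : α ≠ β) {a b a' b' : ℝ} (hsα : HasSupport T₁ T₂ α a b) (hsβ : HasSupport T₁ T₂ β a' b')
    {x₀ y₀ : E} (hx₀ : x₀ ∈ genSubspace hα) (hy₀ : y₀ ∈ genSubspace hβ)
    (h0 : jointForm T₁ T₂ x₀ y₀ ≠ 0) {x y : E} (hx : x ∈ genSubspace hα)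
    (hy : y ∈ genSubspace hβ) : ∃ k : ℂ, jointForm T₁ T₂ x y = k • jointForm T₁ T₂ x₀ y₀ := by
  obtain ⟨v, hv⟩ := exists_jointForm_eq_smul h₁ h₂ hα hβ hne hsα hsβ
  obtain ⟨k₀, hk₀⟩ := hv x₀ hx₀ y₀ hy₀
  obtain ⟨k, hk⟩ := hv x hx y hy
  have hk0 : k₀ ≠ 0 := by
    rintro rfl
    exact h0 (by rw [hk₀, zero_smul])
  exact ⟨k / k₀, by rw [hk, hk₀, smul_smul, div_mul_cancel₀ _ hk0]⟩

/-- If `e`, `f` and `e + f` generate three distinct extreme values, then every further vector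
generating the first value and orthogonal to `e` is orthogonal to `f` for all three forms. -/
theorem jointForm_eq_zero_of_triple (h₁ : T₁.IsSymmetric) (h₂ : T₂.IsSymmetric)
    (hα : IsExtremeValue T₁ T₂ α) (hβ : IsExtremeValue T₁ T₂ β) (hγ : IsExtremeValue T₁ T₂ γ)
    (hαβ : α ≠ β) (hαγ : α ≠ γ) {a b a' b' a'' b'' : ℝ} (hsα : HasSupport T₁ T₂ α a b)
    (hsβ : HasSupport T₁ T₂ β a' b') (hsγ : HasSupport T₁ T₂ γ a'' b'')
    {e f e' : E} (he : e ∈ genSubspace hα) (hf : f ∈ genSubspace hβ)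
    (hz : e + f ∈ genSubspace hγ) (he0 : e ≠ 0) (he' : e' ∈ genSubspace hα)
    (horth : ⟪e', e⟫ = 0) : jointForm T₁ T₂ e' f = 0 := by
  by_contra hw
  set w := jointForm T₁ T₂ e' f with hwdef
  have hee : jointForm T₁ T₂ e' e = 0 := by
    rw [jointForm_of_mem h₁ h₂ hα he' he, horth, zero_smul]
  have hwz : jointForm T₁ T₂ e' (e + f) = w := by rw [jointForm_add_right, hee, zero_add]
  obtain ⟨k, hk⟩ := exists_jointForm_eq_smul_of_ne_zero h₁ h₂ hα hβ hαβ hsα hsβ he' hf hw he hf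
  rw [← hwdef] at hk
  obtain ⟨l, hl⟩ := exists_jointForm_eq_smul_of_ne_zero h₁ h₂ hα hγ hαγ hsα hsγ he' hz
    (by rwa [hwz]) he hz
  rw [hwz] at hl
  have hself := jointForm_of_mem h₁ h₂ hα he he
  have hlin : jointForm T₁ T₂ e e = (l - k) • w := by
    rw [sub_smul, ← hl, jointForm_add_right, hk]
    simp
  have hee0 : ⟪e, e⟫ ≠ 0 := inner_self_ne_zero.mpr he0
  have hlk : l - k ≠ 0 := by
    intro h
    rw [h, zero_smul] at hlin
    exact hee0 (congrArg Prod.fst hlin)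
  set u : ℂ × ℂ × ℂ := (1, (α.1 : ℂ), (α.2 : ℂ)) with hu
  have hwu : w = (⟪e, e⟫ / (l - k)) • u := by
    have : (l - k)⁻¹ • ((l - k) • w) = (l - k)⁻¹ • (⟪e, e⟫ • u) := by rw [← hlin, hself]
    rw [smul_smul, inv_mul_cancel₀ hlk, one_smul, smul_smul] at this
    rw [this, div_eq_inv_mul]
  have hef : ∀ (g : E) (r : ℂ), jointForm T₁ T₂ e g = r • u → jointForm T₁ T₂ e g = ⟪e, g⟫ • u := by
    intro g r h
    have : ⟪e, g⟫ = r := by simpa [jointForm, hu] using congrArg Prod.fst h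
    rw [h, this]
  have orth : ∀ {δ : ℝ × ℝ} (hδ : IsExtremeValue T₁ T₂ δ), α ≠ δ → ∀ g ∈ genSubspace hδ,
      ∀ r : ℂ, jointForm T₁ T₂ e g = r • u → ⟪e, g⟫ = 0 := by
    intro δ hδ hne g hg r h
    have h' := hef g r h
    set c := ⟪e, g⟫ / ⟪e, e⟫ with hc
    have hF : jointForm T₁ T₂ e (g - c • e) = 0 := by
      rw [jointForm_sub_right, jointForm_smul_right, hself, h', smul_smul, hc,
        div_mul_cancel₀ _ hee0, sub_self]
    have hF' : jointForm T₁ T₂ (c • e) (g - c • e) = 0 := by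
      rw [jointForm_smul_left, hF, smul_zero]
    have hmem := hδ.mem_of_add_mem h₁ h₂ hF' (by simpa using hg)
    have h0 := Submodule.disjoint_def.mp (disjoint_genSubspace hα hδ hne) _
      (Submodule.smul_mem _ c he) hmem
    have hc0 := (smul_eq_zero.mp h0).resolve_right he0
    rw [hc] at hc0
    exact (div_eq_zero_iff.mp hc0).resolve_right hee0
  have o1 := orth hβ hαβ f hf _ (by rw [hk, hwu, smul_smul])
  have o2 := orth hγ hαγ (e + f) hz _ (by rw [hl, hwu, smul_smul])
  rw [inner_add_right, o1, add_zero] at o2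
  exact hee0 o2

/-- Two subspaces are orthogonal with respect to all three forms. -/
def JointOrth (T₁ T₂ : E →ₗ[ℂ] E) (M N : Submodule ℂ E) : Prop :=
  ∀ m ∈ M, ∀ n ∈ N, jointForm T₁ T₂ m n = 0

/-- `E` is not the sum of two nonzero jointly orthogonal subspaces. -/
def IsIrreduciblePair (T₁ T₂ : E →ₗ[ℂ] E) : Prop :=
  ∀ M N : Submodule ℂ E, JointOrth T₁ T₂ M N → M ≠ ⊥ → N ≠ ⊥ →
    Module.finrank ℂ M + Module.finrank ℂ N < Module.finrank ℂ E

theorem JointOrth.symm (h₁ : T₁.IsSymmetric) (h₂ : T₂.IsSymmetric) {M N : Submodule ℂ E}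
    (h : JointOrth T₁ T₂ M N) : JointOrth T₁ T₂ N M :=
  fun n hn m hm => jointForm_eq_zero_symm h₁ h₂ (h m hm n hn)

theorem JointOrth.sup_right {M N N' : Submodule ℂ E} (h : JointOrth T₁ T₂ M N)
    (h' : JointOrth T₁ T₂ M N') : JointOrth T₁ T₂ M (N ⊔ N') := by
  intro m hm n hn
  obtain ⟨y, hy, z, hz, rfl⟩ := Submodule.mem_sup.mp hn
  rw [jointForm_add_right, h m hm y hy, h' m hm z hz, add_zero]

theorem JointOrth.sup_left {M M' N : Submodule ℂ E} (h : JointOrth T₁ T₂ M N)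
    (h' : JointOrth T₁ T₂ M' N) : JointOrth T₁ T₂ (M ⊔ M') N := by
  intro m hm n hn
  obtain ⟨y, hy, z, hz, rfl⟩ := Submodule.mem_sup.mp hm
  rw [jointForm_add_left, h y hy n hn, h' z hz n hn, add_zero]

theorem jointOrth_span_singleton {x y : E} (h : jointForm T₁ T₂ x y = 0) :
    JointOrth T₁ T₂ (ℂ ∙ x) (ℂ ∙ y) := by
  intro m hm n hn
  obtain ⟨c, rfl⟩ := Submodule.mem_span_singleton.mp hm
  obtain ⟨d, rfl⟩ := Submodule.mem_span_singleton.mp hn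
  rw [jointForm_smul_left, jointForm_smul_right, h, smul_zero, smul_zero]

theorem finrank_sup_of_disjoint [FiniteDimensional ℂ E] {M N : Submodule ℂ E}
    (h : Disjoint M N) : Module.finrank ℂ (M ⊔ N : Submodule ℂ E)
      = Module.finrank ℂ M + Module.finrank ℂ N := by
  rw [← Submodule.finrank_sup_add_finrank_inf_eq, h.eq_bot, finrank_bot, add_zero]

theorem finrank_span_sup_span [FiniteDimensional ℂ E] {L M : Submodule ℂ E} (h : Disjoint L M)
    {x y : E} (hx : x ∈ L) (hy : y ∈ M) (hx0 : x ≠ 0) (hy0 : y ≠ 0) :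
    Module.finrank ℂ ((ℂ ∙ x) ⊔ (ℂ ∙ y) : Submodule ℂ E) = 2 := by
  rw [finrank_sup_of_disjoint, finrank_span_singleton hx0, finrank_span_singleton hy0]
  exact h.mono ((Submodule.span_singleton_le_iff_mem _ _).mpr hx)
    ((Submodule.span_singleton_le_iff_mem _ _).mpr hy)

theorem exists_mem_ne_zero_inner_eq_zero [FiniteDimensional ℂ E] {L : Submodule ℂ E}
    (hL : 2 ≤ Module.finrank ℂ L) (x : E) : ∃ y ∈ L, y ≠ 0 ∧ ⟪y, x⟫ = 0 := by
  have hker := LinearMap.ker_ne_bot_of_finrank_lt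
    (f := (innerₛₗ ℂ x).comp L.subtype) (by rw [Module.finrank_self]; omega)
  obtain ⟨y, hy, hy0⟩ := Submodule.exists_mem_ne_zero_of_ne_bot hker
  exact ⟨y, y.2, by simpa using hy0, inner_eq_zero_symm.mp (by simpa using hy)⟩

theorem two_mul_finrank_genSubspace_le [FiniteDimensional ℂ E] (h₁ : T₁.IsSymmetric)
    (h₂ : T₂.IsSymmetric) (hirr : IsIrreduciblePair T₁ T₂) (hE : 2 ≤ Module.finrank ℂ E)
    (hα : IsExtremeValue T₁ T₂ α) {a b : ℝ} (hs : HasSupport T₁ T₂ α a b) :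
    2 * Module.finrank ℂ (genSubspace hα) ≤ Module.finrank ℂ E := by
  set L := genSubspace hα with hLdef
  set S : E →ₗ[ℂ] E := (a : ℂ) • (T₂ - (α.2 : ℂ) • LinearMap.id)
    - (b : ℂ) • (T₁ - (α.1 : ℂ) • LinearMap.id) with hS
  have hSapp : ∀ x, S x = (a : ℂ) • (T₂ x - (α.2 : ℂ) • x) - (b : ℂ) • (T₁ x - (α.1 : ℂ) • x) :=
    fun x => by simp [hS]
  have hmaps : ∀ x ∈ L, S x ∈ Lᗮ := by
    intro x hx y hy
    have := jointForm_of_mem h₁ h₂ hα hy hx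
    simp only [jointForm, Prod.smul_mk, Prod.mk.injEq, smul_eq_mul] at this
    rw [hSapp]
    simp only [inner_sub_right, inner_smul_right, this.2.1, this.2.2]
    ring
  have hinj : ∀ x ∈ L, S x = 0 → x = 0 := by
    intro x hx h0
    by_contra hx0
    have e1 := hs.2 x hx
    rw [hSapp] at h0
    have hab : (a : ℂ) ^ 2 + (b : ℂ) ^ 2 ≠ 0 := by
      have : a ^ 2 + b ^ 2 ≠ 0 := by
        intro h
        have h1 : a = 0 := by nlinarith [sq_nonneg a, sq_nonneg b]
        have h2 : b = 0 := by nlinarith [sq_nonneg a, sq_nonneg b]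
        rcases hs.1 with h | h <;> contradiction
      exact_mod_cast this
    push_cast at e1
    have e1' : (a : ℂ) • (T₁ x - (α.1 : ℂ) • x) + (b : ℂ) • (T₂ x - (α.2 : ℂ) • x) = 0 := by
      rw [← sub_eq_zero] at e1
      rw [← e1]
      module
    have t1 : T₁ x - (α.1 : ℂ) • x = 0 := by
      apply (smul_eq_zero.mp (?_ : ((a : ℂ) ^ 2 + (b : ℂ) ^ 2) • (T₁ x - (α.1 : ℂ) • x) = 0)).resolve_left hab
      calc _ = (a : ℂ) • ((a : ℂ) • (T₁ x - (α.1 : ℂ) • x) + (b : ℂ) • (T₂ x - (α.2 : ℂ) • x))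
          - (b : ℂ) • ((a : ℂ) • (T₂ x - (α.2 : ℂ) • x) - (b : ℂ) • (T₁ x - (α.1 : ℂ) • x)) := by
            module
        _ = 0 := by rw [e1', h0]; simp
    have t2 : T₂ x - (α.2 : ℂ) • x = 0 := by
      apply (smul_eq_zero.mp (?_ : ((a : ℂ) ^ 2 + (b : ℂ) ^ 2) • (T₂ x - (α.2 : ℂ) • x) = 0)).resolve_left hab
      calc _ = (b : ℂ) • ((a : ℂ) • (T₁ x - (α.1 : ℂ) • x) + (b : ℂ) • (T₂ x - (α.2 : ℂ) • x))
          + (a : ℂ) • ((a : ℂ) • (T₂ x - (α.2 : ℂ) • x) - (b : ℂ) • (T₁ x - (α.1 : ℂ) • x)) := by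
            module
        _ = 0 := by rw [e1', h0]; simp
    rw [sub_eq_zero] at t1 t2
    have horth : JointOrth T₁ T₂ (ℂ ∙ x)ᗮ (ℂ ∙ x) := by
      intro n hn m hm
      obtain ⟨c, rfl⟩ := Submodule.mem_span_singleton.mp hm
      have : ⟪n, x⟫ = 0 :=
        inner_eq_zero_symm.mp (Submodule.mem_orthogonal_singleton_iff_inner_right.mp hn)
      simp [jointForm, t1, t2, inner_smul_right, this]
    have hsum := Submodule.finrank_add_finrank_orthogonal (ℂ ∙ x)
    have h1 := finrank_span_singleton (K := ℂ) hx0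
    have := hirr _ _ horth (by
      intro hbot
      rw [hbot, finrank_bot] at hsum
      omega) (by simpa using hx0)
    omega
  have hle : Module.finrank ℂ L ≤ Module.finrank ℂ Lᗮ := by
    refine LinearMap.finrank_le_finrank_of_injective
      (f := (S.comp L.subtype).codRestrict Lᗮ (fun x => hmaps x x.2)) ?_
    rw [← LinearMap.ker_eq_bot, LinearMap.ker_eq_bot']
    intro x hx
    have := hinj x x.2 (congrArg Subtype.val hx :)
    exact Subtype.ext this
  have := Submodule.finrank_add_finrank_orthogonal L
  omega

/-- In dimension four, an irreducible pair has at most one multiply generated extreme value. -/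
theorem not_two_extremeValues_of_finrank_eq_four [FiniteDimensional ℂ E] (h₁ : T₁.IsSymmetric)
    (h₂ : T₂.IsSymmetric) (hirr : IsIrreduciblePair T₁ T₂) (hE : Module.finrank ℂ E = 4)
    (hα : IsExtremeValue T₁ T₂ α) (hβ : IsExtremeValue T₁ T₂ β)
    (hαβ : α ≠ β) {a b a' b' : ℝ} (hsα : HasSupport T₁ T₂ α a b) (hsβ : HasSupport T₁ T₂ β a' b')
    (hLα : 2 ≤ Module.finrank ℂ (genSubspace hα)) (hLβ : 2 ≤ Module.finrank ℂ (genSubspace hβ)) :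
    False := by
  have hdisj := disjoint_genSubspace hα hβ hαβ
  obtain ⟨v, hv⟩ := exists_jointForm_eq_smul h₁ h₂ hα hβ hαβ hsα hsβ
  obtain ⟨T, hT⟩ : ∃ T : E →ₗ[ℂ] E, ∀ x ∈ genSubspace hα, ∀ y ∈ genSubspace hβ,
      ⟪x, T y⟫ = 0 → jointForm T₁ T₂ x y = 0 := by
    by_cases hv1 : v.1 = 0
    · by_cases hv2 : v.2.1 = 0
      · refine ⟨T₂, fun x hx y hy h => ?_⟩
        obtain ⟨k, hk⟩ := hv x hx y hy
        have : k * v.2.2 = 0 := by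
          rw [← h]; exact (congrArg (fun w => w.2.2) hk).symm
        rw [hk]
        ext <;> simp [hv1, hv2, this]
      · refine ⟨T₁, fun x hx y hy h => ?_⟩
        obtain ⟨k, hk⟩ := hv x hx y hy
        have : k * v.2.1 = 0 := by
          rw [← h]; exact (congrArg (fun w => w.2.1) hk).symm
        rw [hk, (mul_eq_zero.mp this).resolve_right hv2, zero_smul]
    · refine ⟨LinearMap.id, fun x hx y hy h => ?_⟩
      obtain ⟨k, hk⟩ := hv x hx y hy
      have : k * v.1 = 0 := by
        rw [← h]; exact (congrArg (fun w => w.1) hk).symm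
      rw [hk, (mul_eq_zero.mp this).resolve_right hv1, zero_smul]
  set Lα := genSubspace hα with hLαdef
  set Lβ := genSubspace hβ with hLβdef
  set R : E →ₗ[ℂ] E := (Lα.starProjection : E →ₗ[ℂ] E).comp T with hR
  have hRinner : ∀ e ∈ Lα, ∀ y, ⟪e, R y⟫ = ⟪e, T y⟫ := by
    intro e he y
    have : R y = Lα.starProjection (T y) := rfl
    rw [this, ← Submodule.inner_starProjection_left_eq_right,
      Submodule.starProjection_eq_self_iff.mpr he]
  have hRmem : ∀ y, R y ∈ Lα := fun y => Submodule.starProjection_apply_mem _ _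
  have : Nontrivial Lβ := Module.nontrivial_of_finrank_pos (R := ℂ) (by omega)
  obtain ⟨μ, hμ⟩ := Module.End.exists_eigenvalue
    (((Lβ.orthogonalProjectionOnto : E →ₗ[ℂ] Lβ).comp (LinearMap.adjoint R)).comp
      (R.comp Lβ.subtype) : Module.End ℂ Lβ)
  obtain ⟨f₁, hf₁⟩ := hμ.exists_hasEigenvector
  have hf₁0 : (f₁ : E) ≠ 0 := by simpa using hf₁.2
  have hRR : ∀ f ∈ Lβ, ⟪R f, R f₁⟫ = μ * ⟪f, (f₁ : E)⟫ := by
    intro f hf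
    have := congrArg (fun w : Lβ => ⟪f, (w : E)⟫) hf₁.apply_eq_smul
    simp only [Submodule.coe_smul, inner_smul_right] at this
    rw [← this, ← LinearMap.adjoint_inner_right]
    change _ = ⟪f, Lβ.starProjection (LinearMap.adjoint R (R f₁))⟫
    rw [← Submodule.inner_starProjection_left_eq_right,
      Submodule.starProjection_eq_self_iff.mpr hf]
  obtain ⟨f₂, hf₂, hf₂0, hf₂f₁⟩ := exists_mem_ne_zero_inner_eq_zero hLβ (f₁ : E)
  obtain ⟨e₁, he₁, he₁0, he₁f₂, he₁'⟩ : ∃ e₁ ∈ Lα, e₁ ≠ 0 ∧ ⟪e₁, T f₂⟫ = 0 ∧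
      ∀ e ∈ Lα, ⟪e, e₁⟫ = 0 → ⟪e, T f₁⟫ = 0 := by
    by_cases h0 : R f₁ = 0
    · obtain ⟨e₁, he₁, he₁0, h⟩ := exists_mem_ne_zero_inner_eq_zero hLα (T f₂)
      exact ⟨e₁, he₁, he₁0, h, fun e he _ => by rw [← hRinner e he, h0, inner_zero_right]⟩
    · refine ⟨R f₁, hRmem _, h0, ?_, fun e he h => by rw [← hRinner e he, h]⟩
      rw [← hRinner _ (hRmem _)]
      apply inner_eq_zero_symm.mp
      rw [hRR f₂ hf₂, hf₂f₁, mul_zero]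
  obtain ⟨e₂, he₂, he₂0, he₂e₁⟩ := exists_mem_ne_zero_inner_eq_zero hLα e₁
  have o1 : jointForm T₁ T₂ e₂ e₁ = 0 := by
    rw [jointForm_of_mem h₁ h₂ hα he₂ he₁, he₂e₁, zero_smul]
  have o2 : jointForm T₁ T₂ f₂ f₁ = 0 := by
    rw [jointForm_of_mem h₁ h₂ hβ hf₂ f₁.2, hf₂f₁, zero_smul]
  have o3 := hT e₂ he₂ f₁ f₁.2 (he₁' e₂ he₂ he₂e₁)
  have o4 := jointForm_eq_zero_symm h₁ h₂ (hT e₁ he₁ f₂ hf₂ he₁f₂)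
  have horth : JointOrth T₁ T₂ ((ℂ ∙ e₂) ⊔ (ℂ ∙ f₂)) ((ℂ ∙ e₁) ⊔ (ℂ ∙ (f₁ : E))) :=
    ((jointOrth_span_singleton o1).sup_right (jointOrth_span_singleton o3)).sup_left
      ((jointOrth_span_singleton o4).sup_right (jointOrth_span_singleton o2))
  have r1 := finrank_span_sup_span hdisj he₂ hf₂ he₂0 hf₂0
  have r2 := finrank_span_sup_span hdisj he₁ f₁.2 he₁0 hf₁0
  have := hirr _ _ horth (fun h => by rw [h, finrank_bot] at r1; omega)
    (fun h => by rw [h, finrank_bot] at r2; omega)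
  omega

theorem not_splitting_of_finrank_eq_five [FiniteDimensional ℂ E] (h₁ : T₁.IsSymmetric)
    (h₂ : T₂.IsSymmetric) (hirr : IsIrreduciblePair T₁ T₂) (hE : Module.finrank ℂ E = 5)
    (hα : IsExtremeValue T₁ T₂ α) (hβ : IsExtremeValue T₁ T₂ β) (hγ : IsExtremeValue T₁ T₂ γ)
    (hαβ : α ≠ β) (hαγ : α ≠ γ) (hβγ : β ≠ γ) {a b a' b' a'' b'' : ℝ}
    (hsα : HasSupport T₁ T₂ α a b) (hsβ : HasSupport T₁ T₂ β a' b')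
    (hsγ : HasSupport T₁ T₂ γ a'' b'')
    (hLα : 2 ≤ Module.finrank ℂ (genSubspace hα)) (hLβ : 2 ≤ Module.finrank ℂ (genSubspace hβ))
    {e f n : E} (he : e ∈ genSubspace hα) (hf : f ∈ genSubspace hβ)
    (hz : e + f ∈ genSubspace hγ) (hz0 : e + f ≠ 0) (hn : n ∉ genSubspace hα ⊔ genSubspace hβ)
    (hne : jointForm T₁ T₂ n e = 0) (hnf : jointForm T₁ T₂ n f = 0) : False := by
  have hdisj := disjoint_genSubspace hα hβ hαβ
  have he0 : e ≠ 0 := by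
    rintro rfl
    rw [zero_add] at hz hz0
    exact hz0 (Submodule.disjoint_def.mp (disjoint_genSubspace hβ hγ hβγ) _ hf hz)
  have hf0 : f ≠ 0 := by
    rintro rfl
    rw [add_zero] at hz hz0
    exact hz0 (Submodule.disjoint_def.mp (disjoint_genSubspace hα hγ hαγ) _ he hz)
  obtain ⟨e', he', he'0, hee⟩ := exists_mem_ne_zero_inner_eq_zero hLα e
  obtain ⟨f', hf', hf'0, hff⟩ := exists_mem_ne_zero_inner_eq_zero hLβ f
  have o1 : jointForm T₁ T₂ e' e = 0 := by
    rw [jointForm_of_mem h₁ h₂ hα he' he, hee, zero_smul]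
  have o2 : jointForm T₁ T₂ f' f = 0 := by
    rw [jointForm_of_mem h₁ h₂ hβ hf' hf, hff, zero_smul]
  have o3 := jointForm_eq_zero_of_triple h₁ h₂ hα hβ hγ hαβ hαγ hsα hsβ hsγ he hf hz he0 he' hee
  have o4 := jointForm_eq_zero_of_triple h₁ h₂ hβ hα hγ hαβ.symm hβγ hsβ hsα hsγ hf he
    (by rwa [add_comm]) hf0 hf' hff
  have horth : JointOrth T₁ T₂ (((ℂ ∙ e') ⊔ (ℂ ∙ f')) ⊔ (ℂ ∙ n)) ((ℂ ∙ e) ⊔ (ℂ ∙ f)) :=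
    (((jointOrth_span_singleton o1).sup_right (jointOrth_span_singleton o3)).sup_left
      ((jointOrth_span_singleton o4).sup_right (jointOrth_span_singleton o2))).sup_left
      ((jointOrth_span_singleton hne).sup_right (jointOrth_span_singleton hnf))
  have r1 := finrank_span_sup_span hdisj he' hf' he'0 hf'0
  have r2 := finrank_span_sup_span hdisj he hf he0 hf0
  have hn0 : n ≠ 0 := fun h => hn (h ▸ Submodule.zero_mem _)
  have hle : (ℂ ∙ e') ⊔ (ℂ ∙ f') ≤ genSubspace hα ⊔ genSubspace hβ :=
    sup_le_sup ((Submodule.span_singleton_le_iff_mem _ _).mpr he')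
      ((Submodule.span_singleton_le_iff_mem _ _).mpr hf')
  have r3 : Module.finrank ℂ (((ℂ ∙ e') ⊔ (ℂ ∙ f')) ⊔ (ℂ ∙ n) : Submodule ℂ E) = 3 := by
    rw [finrank_sup_of_disjoint, r1, finrank_span_singleton hn0]
    exact (Submodule.disjoint_span_singleton' hn0).mpr fun h => hn (hle h)
  have := hirr _ _ horth (fun h => by rw [h, finrank_bot] at r3; omega)
    (fun h => by rw [h, finrank_bot] at r2; omega)
  omega

theorem exists_add_mem_of_le_sup [FiniteDimensional ℂ E] {L M N : Submodule ℂ E}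
    (hL : 2 ≤ Module.finrank ℂ L) (hle : L ≤ M ⊔ N) (ξ : E →ₗ[ℂ] ℂ) :
    ∃ e ∈ M, ∃ f ∈ N, e + f ∈ L ∧ e + f ≠ 0 ∧ ξ e = 0 := by
  have : Nontrivial L := Module.nontrivial_of_finrank_pos (R := ℂ) (by omega)
  obtain ⟨z₁, hz₁0⟩ := exists_ne (0 : L)
  obtain ⟨z₂, hz₂, hz₂0, horth⟩ := exists_mem_ne_zero_inner_eq_zero hL (z₁ : E)
  obtain ⟨e₁, he₁, f₁, hf₁, hz₁⟩ := Submodule.mem_sup.mp (hle z₁.2)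
  obtain ⟨e₂, he₂, f₂, hf₂, hz₂'⟩ := Submodule.mem_sup.mp (hle hz₂)
  have hz₁0' : e₁ + f₁ ≠ 0 := by rw [hz₁]; simpa using hz₁0
  by_cases h1 : ξ e₁ = 0
  · exact ⟨e₁, he₁, f₁, hf₁, hz₁ ▸ z₁.2, hz₁0', h1⟩
  · have hsum : ξ e₂ • e₁ - ξ e₁ • e₂ + (ξ e₂ • f₁ - ξ e₁ • f₂) = ξ e₂ • (z₁ : E) - ξ e₁ • z₂ := by
      rw [← hz₁, ← hz₂']; module
    refine ⟨ξ e₂ • e₁ - ξ e₁ • e₂, M.sub_mem (M.smul_mem _ he₁) (M.smul_mem _ he₂),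
      ξ e₂ • f₁ - ξ e₁ • f₂, N.sub_mem (N.smul_mem _ hf₁) (N.smul_mem _ hf₂), ?_, ?_, ?_⟩
    · rw [hsum]
      exact L.sub_mem (L.smul_mem _ z₁.2) (L.smul_mem _ hz₂)
    · rw [hsum]
      intro h0
      have := congrArg (fun v => ⟪z₂, v⟫) h0
      simp only [inner_sub_right, inner_smul_right, horth, inner_zero_right, mul_zero, zero_sub,
        neg_eq_zero, mul_eq_zero, h1, false_or, inner_self_eq_zero] at this
      exact hz₂0 this
    · simp [mul_comm]

theorem det_eq_zero_of_le_sup [FiniteDimensional ℂ E] (h₁ : T₁.IsSymmetric)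
    (h₂ : T₂.IsSymmetric) (hirr : IsIrreduciblePair T₁ T₂) (hE : Module.finrank ℂ E = 5)
    (hα : IsExtremeValue T₁ T₂ α) (hβ : IsExtremeValue T₁ T₂ β) (hγ : IsExtremeValue T₁ T₂ γ)
    (hαβ : α ≠ β) (hαγ : α ≠ γ) (hβγ : β ≠ γ) {a b a' b' a'' b'' : ℝ}
    (hsα : HasSupport T₁ T₂ α a b) (hsβ : HasSupport T₁ T₂ β a' b')
    (hsγ : HasSupport T₁ T₂ γ a'' b'')
    (hLα : 2 ≤ Module.finrank ℂ (genSubspace hα)) (hLβ : 2 ≤ Module.finrank ℂ (genSubspace hβ))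
    (hLγ : 2 ≤ Module.finrank ℂ (genSubspace hγ))
    (hle : genSubspace hγ ≤ genSubspace hα ⊔ genSubspace hβ)
    {w : E} (hw : w ∈ (genSubspace hα ⊔ genSubspace hβ)ᗮ) (hw0 : w ≠ 0) :
    a'' * b' - a' * b'' = 0 := by
  by_contra hdet
  obtain ⟨e, he, f, hf, hz, hz0, hξ⟩ := exists_add_mem_of_le_sup hLγ hle
    ((innerₛₗ ℂ w).comp ((a : ℂ) • T₂ - (b : ℂ) • T₁))
  simp only [LinearMap.comp_apply, LinearMap.sub_apply, LinearMap.smul_apply, innerₛₗ_apply_apply,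
    inner_sub_right, inner_smul_right] at hξ
  have hwV : ∀ v ∈ genSubspace hα ⊔ genSubspace hβ, ⟪w, v⟫ = 0 :=
    fun v hv => inner_eq_zero_symm.mp (hw v hv)
  have hwe := hwV e (Submodule.mem_sup_left he)
  have hwf := hwV f (Submodule.mem_sup_right hf)
  have solve : ∀ {p q r s : ℝ} {x y : ℂ}, p * s - q * r ≠ 0 → (p : ℂ) * x + q * y = 0 →
      (r : ℂ) * x + s * y = 0 → x = 0 ∧ y = 0 := by
    intro p q r s x y hd e1 e2
    have hd' : (p * s - q * r : ℂ) ≠ 0 := by exact_mod_cast hd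
    constructor
    · apply (mul_eq_zero.mp (?_ : (p * s - q * r : ℂ) * x = 0)).resolve_left hd'
      linear_combination (s : ℂ) * e1 - q * e2
    · apply (mul_eq_zero.mp (?_ : (p * s - q * r : ℂ) * y = 0)).resolve_left hd'
      linear_combination (p : ℂ) * e2 - r * e1
  have hFe : ⟪w, T₁ e⟫ = 0 ∧ ⟪w, T₂ e⟫ = 0 := by
    refine solve (p := a) (q := b) (r := -b) (s := a) ?_ ?_ ?_
    · intro h
      have h1 : a = 0 := by nlinarith [sq_nonneg a, sq_nonneg b]
      have h2 : b = 0 := by nlinarith [sq_nonneg a, sq_nonneg b]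
      rcases hsα.1 with h | h <;> contradiction
    · rw [hsα.inner_left hα he, hwe, mul_zero]
    · push_cast
      linear_combination hξ
  have hFf : ⟪w, T₁ f⟫ = 0 ∧ ⟪w, T₂ f⟫ = 0 := by
    refine solve (p := a'') (q := b'') (r := a') (s := b') (by rwa [mul_comm b'']) ?_ ?_
    · have := hsγ.inner_left hγ hz w
      simpa only [map_add, inner_add_right, hFe.1, hFe.2, hwe, hwf, zero_add, mul_zero] using this
    · rw [hsβ.inner_left hβ hf, hwf, mul_zero]
  refine not_splitting_of_finrank_eq_five h₁ h₂ hirr hE hα hβ hγ hαβ hαγ hβγ hsα hsβ hsγ hLα hLβ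
    he hf hz hz0 (n := w) ?_ ?_ ?_
  · exact fun h => hw0 (inner_self_eq_zero.mp (hwV w h))
  · simp [jointForm, hwe, hFe]
  · simp [jointForm, hwf, hFf]

/-- In dimension five, an irreducible pair has at most two multiply generated extreme values. -/
theorem not_three_extremeValues_of_finrank_eq_five [FiniteDimensional ℂ E] (h₁ : T₁.IsSymmetric)
    (h₂ : T₂.IsSymmetric) (hirr : IsIrreduciblePair T₁ T₂) (hE : Module.finrank ℂ E = 5)
    (hα : IsExtremeValue T₁ T₂ α) (hβ : IsExtremeValue T₁ T₂ β) (hγ : IsExtremeValue T₁ T₂ γ)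
    (hαβ : α ≠ β) (hαγ : α ≠ γ) (hβγ : β ≠ γ) {a b a' b' a'' b'' : ℝ}
    (hsα : HasSupport T₁ T₂ α a b) (hsβ : HasSupport T₁ T₂ β a' b')
    (hsγ : HasSupport T₁ T₂ γ a'' b'')
    (hLα : 2 ≤ Module.finrank ℂ (genSubspace hα)) (hLβ : 2 ≤ Module.finrank ℂ (genSubspace hβ))
    (hLγ : 2 ≤ Module.finrank ℂ (genSubspace hγ)) : False := by
  have hdisj := disjoint_genSubspace hα hβ hαβ
  have dα := two_mul_finrank_genSubspace_le h₁ h₂ hirr (by omega) hα hsα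
  have dβ := two_mul_finrank_genSubspace_le h₁ h₂ hirr (by omega) hβ hsβ
  have dγ := two_mul_finrank_genSubspace_le h₁ h₂ hirr (by omega) hγ hsγ
  have dV := finrank_sup_of_disjoint hdisj
  by_cases hle : genSubspace hγ ≤ genSubspace hα ⊔ genSubspace hβ
  · have hV := Submodule.finrank_add_finrank_orthogonal (genSubspace hα ⊔ genSubspace hβ)
    obtain ⟨w, hw, hw0⟩ := Submodule.exists_mem_ne_zero_of_ne_bot
      (p := (genSubspace hα ⊔ genSubspace hβ)ᗮ) (fun h => by rw [h, finrank_bot] at hV; omega)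
    have det₁ := det_eq_zero_of_le_sup h₁ h₂ hirr hE hα hβ hγ hαβ hαγ hβγ hsα hsβ hsγ hLα hLβ hLγ
      hle hw hw0
    have det₂ := det_eq_zero_of_le_sup h₁ h₂ hirr hE hβ hα hγ hαβ.symm hβγ hαγ hsβ hsα hsγ hLβ hLα
      hLγ (by rwa [sup_comm]) (by rwa [sup_comm]) hw0
    have hsβ' := hsβ.of_det_eq_zero hsγ.1 det₁
    have hsα' := hsα.of_det_eq_zero hsγ.1 det₂
    obtain ⟨e, he, f, hf, hz, hz0, -⟩ := exists_add_mem_of_le_sup hLγ hle 0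
    have he0 : e ≠ 0 := by
      rintro rfl
      rw [zero_add] at hz hz0
      exact hz0 (Submodule.disjoint_def.mp (disjoint_genSubspace hβ hγ hβγ) _ hf hz)
    have hf0 : f ≠ 0 := by
      rintro rfl
      rw [add_zero] at hz hz0
      exact hz0 (Submodule.disjoint_def.mp (disjoint_genSubspace hα hγ hαγ) _ he hz)
    have q1 := hsα'.2 e he
    have q2 := hsβ'.2 f hf
    have q3 := hsγ.2 _ hz
    set φα := a'' * α.1 + b'' * α.2 with hφα
    set φβ := a'' * β.1 + b'' * β.2 with hφβ
    set φγ := a'' * γ.1 + b'' * γ.2 with hφγ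
    have q4 : ((φγ : ℂ) - φα) • e = ((φβ : ℂ) - φγ) • f := by
      have : (φα : ℂ) • e + (φβ : ℂ) • f = (φγ : ℂ) • (e + f) := by
        rw [← q1, ← q2, ← q3, map_add, map_add]; module
      rw [← sub_eq_zero] at this ⊢
      rw [← neg_eq_zero, ← this]
      module
    have q5 : ((φγ : ℂ) - φα) • e = 0 :=
      Submodule.disjoint_def.mp hdisj _ (Submodule.smul_mem _ _ he)
        (q4 ▸ Submodule.smul_mem _ _ hf)
    have q6 : φγ = φα := by
      have := (smul_eq_zero.mp q5).resolve_right he0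
      exact_mod_cast sub_eq_zero.mp this
    have q7 : φβ = φγ := by
      have := (smul_eq_zero.mp (q4 ▸ q5)).resolve_right hf0
      exact_mod_cast sub_eq_zero.mp this
    have hcross : (γ.1 - α.1) * (β.2 - α.2) = (γ.2 - α.2) * (β.1 - α.1) := by
      rcases hsγ.1 with h | h
      · apply mul_left_cancel₀ h
        linear_combination (β.2 - α.2) * q6 - (γ.2 - α.2) * (q7 + q6)
      · apply mul_left_cancel₀ h
        linear_combination - (β.1 - α.1) * q6 + (γ.1 - α.1) * (q7 + q6)
    have hpos : (β.1 - α.1) ^ 2 + (β.2 - α.2) ^ 2 ≠ 0 := by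
      intro h
      apply hαβ
      ext <;> nlinarith [sq_nonneg (β.1 - α.1), sq_nonneg (β.2 - α.2)]
    refine hα.not_collinear hβ hγ he hf hz he0 hf0 hz0 hαβ hαγ hβγ
      (s := ((γ.1 - α.1) * (β.1 - α.1) + (γ.2 - α.2) * (β.2 - α.2)) /
        ((β.1 - α.1) ^ 2 + (β.2 - α.2) ^ 2)) ?_
    ext
    · simp only [Prod.fst_add, Prod.smul_fst, Prod.fst_sub, smul_eq_mul]
      field_simp
      linear_combination (β.2 - α.2) * hcross
    · simp only [Prod.snd_add, Prod.smul_snd, Prod.snd_sub, smul_eq_mul]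
      field_simp
      linear_combination (-(β.1 - α.1)) * hcross
  · have hsum := Submodule.finrank_sup_add_finrank_inf_eq (genSubspace hγ)
      (genSubspace hα ⊔ genSubspace hβ)
    have hmax := Submodule.finrank_le (genSubspace hγ ⊔ (genSubspace hα ⊔ genSubspace hβ))
    obtain ⟨z, ⟨hz, hzV⟩, hz0⟩ := Submodule.exists_mem_ne_zero_of_ne_bot
      (p := genSubspace hγ ⊓ (genSubspace hα ⊔ genSubspace hβ))
      (fun h => by rw [h, finrank_bot] at hsum; omega)
    obtain ⟨e, he, f, hf, rfl⟩ := Submodule.mem_sup.mp hzV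
    obtain ⟨z', hz', hz'0, horth⟩ := exists_mem_ne_zero_inner_eq_zero hLγ (e + f)
    refine not_splitting_of_finrank_eq_five h₁ h₂ hirr hE hα hβ hγ hαβ hαγ hβγ hsα hsβ hsγ hLα hLβ
      he hf hz hz0 (n := z') ?_ ?_ ?_
    · intro hmem
      apply hle
      have hspan : (ℂ ∙ (e + f)) ⊔ (ℂ ∙ z') ≤ genSubspace hγ :=
        sup_le ((Submodule.span_singleton_le_iff_mem _ _).mpr hz)
          ((Submodule.span_singleton_le_iff_mem _ _).mpr hz')
      have hdim : Module.finrank ℂ ((ℂ ∙ (e + f)) ⊔ (ℂ ∙ z') : Submodule ℂ E) = 2 := by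
        rw [finrank_sup_of_disjoint, finrank_span_singleton hz0, finrank_span_singleton hz'0]
        refine (Submodule.disjoint_span_singleton' hz'0).mpr fun h => hz'0 ?_
        obtain ⟨c, rfl⟩ := Submodule.mem_span_singleton.mp h
        rw [inner_smul_left, mul_eq_zero, inner_self_eq_zero] at horth
        rcases horth with hc | hc
        · rw [(map_eq_zero _).mp hc, zero_smul]
        · exact absurd hc hz0
      rw [← Submodule.eq_of_le_of_finrank_le hspan (by omega)]
      exact sup_le ((Submodule.span_singleton_le_iff_mem _ _).mpr hzV)
        ((Submodule.span_singleton_le_iff_mem _ _).mpr hmem)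
    · have := jointForm_eq_zero_of_triple h₁ h₂ hγ hα hβ hαγ.symm hβγ.symm hsγ hsα hsβ hz
        (Submodule.neg_mem _ he) (by simpa using hf) hz0 hz' horth
      rw [← neg_one_smul ℂ e, jointForm_smul_right] at this
      simpa using this
    · have := jointForm_eq_zero_of_triple h₁ h₂ hγ hβ hα hβγ.symm hαγ.symm hsγ hsβ hsα hz
        (Submodule.neg_mem _ hf) (by simpa using he) hz0 hz' horth
      rw [← neg_one_smul ℂ f, jointForm_smul_right] at this
      simpa using this

variable {d : ℕ}

theorem isIrreduciblePair_of_not_unitarilyReducible {u₁ u₂ : Matrix (Fin d) (Fin d) ℂ}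
    (h₁ : u₁.IsHermitian) (h₂ : u₂.IsHermitian)
    (hirr : ¬ UnitarilyReducible (u₁ + Complex.I • u₂)) :
    IsIrreduciblePair (Matrix.toEuclideanLin u₁) (Matrix.toEuclideanLin u₂) := by
  intro M N horth hM hN
  by_contra! hge
  apply hirr
  have hdisj : Disjoint M N := by
    rw [Submodule.disjoint_def]
    intro x hx hy
    exact inner_self_eq_zero.mp (congrArg Prod.fst (horth x hx x hy))
  have hsum := finrank_sup_of_disjoint hdisj
  have hle := Submodule.finrank_le (M ⊔ N)
  rw [finrank_euclideanSpace_fin] at hge hle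
  obtain ⟨a, ha⟩ : ∃ a, Module.finrank ℂ M = a := ⟨_, rfl⟩
  obtain ⟨b, hb⟩ : ∃ b, Module.finrank ℂ N = b := ⟨_, rfl⟩
  have hab : a + b = d := by omega
  refine ⟨a, b, hab, ?_, ?_, ?_⟩
  · rw [← ha, Nat.pos_iff_ne_zero]
    exact fun h => hM (Submodule.finrank_eq_zero.mp h)
  · rw [← hb, Nat.pos_iff_ne_zero]
    exact fun h => hN (Submodule.finrank_eq_zero.mp h)
  set bM := (stdOrthonormalBasis ℂ M).reindex (finCongr ha)
  set bN := (stdOrthonormalBasis ℂ N).reindex (finCongr hb)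
  set A := u₁ + Complex.I • u₂ with hA
  set T := Matrix.toEuclideanLin A with hT
  have hTapp : ∀ x, T x = Matrix.toEuclideanLin u₁ x + Complex.I • Matrix.toEuclideanLin u₂ x := by
    intro x
    simp [hT, hA]
  set e := finSumFinEquiv.trans (finCongr hab) with he
  set c : Fin a ⊕ Fin b → EuclideanSpace ℂ (Fin d) :=
    Sum.elim (fun i => (bM i : EuclideanSpace ℂ (Fin d))) (fun i => bN i) with hc
  have hMN : ∀ m ∈ M, ∀ n ∈ N, ⟪m, n⟫ = 0 ∧ ⟪m, T n⟫ = 0 := by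
    intro m hm n hn
    have := horth m hm n hn
    simp only [jointForm, Prod.mk_eq_zero] at this
    refine ⟨this.1, ?_⟩
    rw [hTapp, inner_add_right, inner_smul_right, this.2.1, this.2.2, mul_zero, add_zero]
  have hNM : ∀ n ∈ N, ∀ m ∈ M, ⟪n, m⟫ = 0 ∧ ⟪n, T m⟫ = 0 := by
    intro n hn m hm
    have := jointForm_eq_zero_symm (Matrix.isSymmetric_toEuclideanLin_iff.mpr h₁)
      (Matrix.isSymmetric_toEuclideanLin_iff.mpr h₂) (horth m hm n hn)
    simp only [jointForm, Prod.mk_eq_zero] at this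
    refine ⟨this.1, ?_⟩
    rw [hTapp, inner_add_right, inner_smul_right, this.2.1, this.2.2, mul_zero, add_zero]
  have hcc : ∀ i j, ⟪c i, c j⟫ = if i = j then 1 else 0 := by
    rintro (i | i) (j | j)
    · simpa [hc] using orthonormal_iff_ite.mp bM.orthonormal i j
    · simpa [hc] using (hMN _ (bM i).2 _ (bN j).2).1
    · simpa [hc] using (hNM _ (bN i).2 _ (bM j).2).1
    · simpa [hc] using orthonormal_iff_ite.mp bN.orthonormal i j
  set U : Matrix (Fin d) (Fin d) ℂ := Matrix.of fun i j => c (e.symm j) i with hU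
  have hentry : ∀ (B : Matrix (Fin d) (Fin d) ℂ) i j, (star U * B * U) i j
      = ⟪c (e.symm i), Matrix.toEuclideanLin B (c (e.symm j))⟫ := by
    intro B i j
    rw [Matrix.mul_assoc, EuclideanSpace.inner_eq_star_dotProduct, dotProduct_comm]
    rfl
  refine ⟨U, Matrix.mem_unitaryGroup_iff'.mpr ?_,
    Matrix.of fun i j => ⟪(bM i : EuclideanSpace ℂ (Fin d)), T (bM j)⟫,
    Matrix.of fun i j => ⟪(bN i : EuclideanSpace ℂ (Fin d)), T (bN j)⟫, ?_⟩
  · ext i j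
    have := hentry 1 i j
    rw [mul_one] at this
    rw [this, Matrix.one_apply]
    simpa using hcc (e.symm i) (e.symm j)
  · ext i j
    rw [hentry, Matrix.reindex_apply, Matrix.submatrix_apply]
    rcases e.symm i with i | i <;> rcases e.symm j with j | j
    · rfl
    · exact (hMN _ (bM i).2 _ (bN j).2).2
    · exact (hNM _ (bN i).2 _ (bM j).2).2
    · rfl

variable {d : ℕ}

theorem expVal2_add (u₁ u₂ σ τ : Matrix (Fin d) (Fin d) ℂ) :
    expVal2 u₁ u₂ (σ + τ) = expVal2 u₁ u₂ σ + expVal2 u₁ u₂ τ := by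
  simp [expVal2, mul_add]

theorem expVal2_smul (u₁ u₂ : Matrix (Fin d) (Fin d) ℂ) (r : ℝ) (σ : Matrix (Fin d) (Fin d) ℂ) :
    expVal2 u₁ u₂ (r • σ) = r • expVal2 u₁ u₂ σ := by
  simp [expVal2]

theorem continuous_expVal2 (u₁ u₂ : Matrix (Fin d) (Fin d) ℂ) : Continuous (expVal2 u₁ u₂) := by
  unfold expVal2
  fun_prop

theorem Matrix.PosSemidef.trace_eq_re {σ : Matrix (Fin d) (Fin d) ℂ} (hσ : σ.PosSemidef) :
    σ.trace = (σ.trace.re : ℂ) :=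
  Complex.ext rfl (by simpa using (Complex.nonneg_iff.mp hσ.trace_nonneg).2.symm)

theorem Matrix.PosSemidef.re_trace_nonneg {σ : Matrix (Fin d) (Fin d) ℂ} (hσ : σ.PosSemidef) :
    0 ≤ σ.trace.re :=
  (Complex.nonneg_iff.mp hσ.trace_nonneg).1

theorem Matrix.PosSemidef.eq_zero_of_re_trace {σ : Matrix (Fin d) (Fin d) ℂ} (hσ : σ.PosSemidef)
    (h : σ.trace.re = 0) : σ = 0 :=
  hσ.trace_eq_zero_iff.mp (by rw [hσ.trace_eq_re, h, Complex.ofReal_zero])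

theorem Matrix.PosSemidef.inv_trace_smul_mem_stateSpace {σ : Matrix (Fin d) (Fin d) ℂ}
    (hσ : σ.PosSemidef) (h : σ.trace.re ≠ 0) : σ.trace.re⁻¹ • σ ∈ stateSpace d := by
  refine ⟨hσ.smul (inv_nonneg.mpr hσ.re_trace_nonneg), ?_⟩
  rw [trace_smul]
  conv_lhs => rw [hσ.trace_eq_re]
  rw [Complex.ofReal_re, Complex.real_smul, ← Complex.ofReal_mul, inv_mul_cancel₀ h,
    Complex.ofReal_one]

theorem convex_stateSpace (d : ℕ) : Convex ℝ (stateSpace d) := by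
  rintro σ ⟨hσ, hσ1⟩ τ ⟨hτ, hτ1⟩ a b ha hb hab
  refine ⟨(hσ.smul ha).add (hτ.smul hb), ?_⟩
  rw [trace_add, trace_smul, trace_smul, hσ1, hτ1, ← add_smul, hab, one_smul]

theorem convex_image_stateSpace (u₁ u₂ : Matrix (Fin d) (Fin d) ℂ) :
    Convex ℝ (expVal2 u₁ u₂ '' stateSpace d) :=
  (convex_stateSpace d).is_linear_image ⟨expVal2_add u₁ u₂, expVal2_smul u₁ u₂⟩

/-- Positive semidefinite summands of a matrix over an extreme value lie over this value. -/
theorem expVal2_eq_of_add {u₁ u₂ σ τ : Matrix (Fin d) (Fin d) ℂ} {α : ℝ × ℝ}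
    (hα : α ∈ (expVal2 u₁ u₂ '' stateSpace d).extremePoints ℝ) (hσ : σ.PosSemidef)
    (hτ : τ.PosSemidef) (h : expVal2 u₁ u₂ (σ + τ) = (σ + τ).trace.re • α) :
    expVal2 u₁ u₂ σ = σ.trace.re • α := by
  by_cases hσ0 : σ.trace.re = 0
  · rw [hσ.eq_zero_of_re_trace hσ0]
    simp [expVal2]
  by_cases hτ0 : τ.trace.re = 0
  · rwa [hτ.eq_zero_of_re_trace hτ0, add_zero] at h
  set p := σ.trace.re with hp
  set q := τ.trace.re with hq
  have hp0 : 0 < p := lt_of_le_of_ne hσ.re_trace_nonneg (Ne.symm hσ0)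
  have hq0 : 0 < q := lt_of_le_of_ne hτ.re_trace_nonneg (Ne.symm hτ0)
  rw [expVal2_add, trace_add, Complex.add_re, ← hp, ← hq] at h
  have := (mem_extremePoints_iff_left.mp hα).2 _ ⟨_, hσ.inv_trace_smul_mem_stateSpace hσ0, rfl⟩ _
    ⟨_, hτ.inv_trace_smul_mem_stateSpace hτ0, rfl⟩
    ⟨p / (p + q), q / (p + q), by positivity, by positivity, by field_simp, by
      rw [expVal2_smul, expVal2_smul, smul_smul, smul_smul, ← hp, ← hq]
      have e1 : p / (p + q) * p⁻¹ = (p + q)⁻¹ := by field_simp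
      have e2 : q / (p + q) * q⁻¹ = (p + q)⁻¹ := by field_simp
      rw [e1, e2, ← smul_add, h, smul_smul, inv_mul_cancel₀ (by positivity), one_smul]⟩
  rw [← this, expVal2_smul, smul_smul, ← hp, mul_inv_cancel₀ hσ0, one_smul]

/-- The rank-one positive semidefinite matrix of a vector. -/
noncomputable def rankOneMatrix (x : EuclideanSpace ℂ (Fin d)) : Matrix (Fin d) (Fin d) ℂ :=
  Matrix.vecMulVec x.ofLp (star x.ofLp)

theorem posSemidef_rankOneMatrix (x : EuclideanSpace ℂ (Fin d)) : (rankOneMatrix x).PosSemidef :=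
  Matrix.posSemidef_vecMulVec_self_star _

theorem trace_mul_rankOneMatrix (A : Matrix (Fin d) (Fin d) ℂ) (x : EuclideanSpace ℂ (Fin d)) :
    (A * rankOneMatrix x).trace = ⟪x, Matrix.toEuclideanLin A x⟫ := by
  rw [rankOneMatrix, Matrix.mul_vecMulVec, Matrix.trace_vecMulVec,
    EuclideanSpace.inner_eq_star_dotProduct]
  rfl

theorem trace_rankOneMatrix (x : EuclideanSpace ℂ (Fin d)) :
    (rankOneMatrix x).trace = ((‖x‖ ^ 2 : ℝ) : ℂ) := by
  have := trace_mul_rankOneMatrix 1 x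
  rw [one_mul] at this
  rw [this]
  simp [inner_self_eq_norm_sq_to_K]

theorem re_trace_rankOneMatrix (x : EuclideanSpace ℂ (Fin d)) :
    (rankOneMatrix x).trace.re = ‖x‖ ^ 2 := by
  rw [trace_rankOneMatrix, Complex.ofReal_re]

theorem expVal2_rankOneMatrix (u₁ u₂ : Matrix (Fin d) (Fin d) ℂ) (x : EuclideanSpace ℂ (Fin d)) :
    expVal2 u₁ u₂ (rankOneMatrix x)
      = quadVal (Matrix.toEuclideanLin u₁) (Matrix.toEuclideanLin u₂) x := by
  simp only [expVal2, quadVal, trace_mul_rankOneMatrix]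

theorem rankOneMatrix_smul (c : ℂ) (x : EuclideanSpace ℂ (Fin d)) :
    rankOneMatrix (c • x) = (‖c‖ ^ 2) • rankOneMatrix x := by
  ext i j
  simp only [rankOneMatrix, Matrix.vecMulVec_apply, PiLp.smul_apply, smul_eq_mul, Pi.star_apply,
    Matrix.smul_apply, Complex.real_smul, star_mul', RCLike.star_def, ← Complex.normSq_eq_norm_sq,
    ← Complex.mul_conj]
  ring

open scoped MatrixOrder Matrix.Norms.L2Operator in
theorem Matrix.PosSemidef.exists_eq_conjTranspose_mul_self {σ : Matrix (Fin d) (Fin d) ℂ}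
    (hσ : σ.PosSemidef) : ∃ B : Matrix (Fin d) (Fin d) ℂ, σ = Bᴴ * B :=
  CStarAlgebra.nonneg_iff_eq_star_mul_self.mp hσ.nonneg

theorem Matrix.PosSemidef.exists_eq_sum_rankOneMatrix {σ : Matrix (Fin d) (Fin d) ℂ}
    (hσ : σ.PosSemidef) :
    ∃ y : Fin d → EuclideanSpace ℂ (Fin d), σ = ∑ i, rankOneMatrix (y i) := by
  obtain ⟨B, rfl⟩ := hσ.exists_eq_conjTranspose_mul_self
  refine ⟨fun k => WithLp.toLp 2 (star (B k)), ?_⟩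
  ext i j
  simp [Matrix.mul_apply, Matrix.sum_apply, rankOneMatrix, Matrix.vecMulVec_apply]

theorem isExtremeValue_of_mem_extremePoints {u₁ u₂ : Matrix (Fin d) (Fin d) ℂ} {α : ℝ × ℝ}
    (hα : α ∈ (expVal2 u₁ u₂ '' stateSpace d).extremePoints ℝ) :
    IsExtremeValue (Matrix.toEuclideanLin u₁) (Matrix.toEuclideanLin u₂) α := by
  intro x y h
  have := expVal2_eq_of_add hα (posSemidef_rankOneMatrix x) (posSemidef_rankOneMatrix y)
    (by rw [expVal2_add, trace_add, Complex.add_re, re_trace_rankOneMatrix,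
      re_trace_rankOneMatrix, expVal2_rankOneMatrix, expVal2_rankOneMatrix, h])
  rwa [expVal2_rankOneMatrix, re_trace_rankOneMatrix] at this

theorem exists_hasSupport_of_mem_extremePoints {u₁ u₂ : Matrix (Fin d) (Fin d) ℂ}
    (h₁ : u₁.IsHermitian) (h₂ : u₂.IsHermitian) {α : ℝ × ℝ}
    (hα : α ∈ (expVal2 u₁ u₂ '' stateSpace d).extremePoints ℝ) :
    ∃ a b, HasSupport (Matrix.toEuclideanLin u₁) (Matrix.toEuclideanLin u₂) α a b := by
  obtain ⟨a, b, hab, hle⟩ := (convex_image_stateSpace u₁ u₂).exists_support_of_mem_extremePoints hα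
  refine ⟨a, b, hab, fun x hx => ?_⟩
  set T₁ := Matrix.toEuclideanLin u₁ with hT₁
  set T₂ := Matrix.toEuclideanLin u₂ with hT₂
  have hs₁ : T₁.IsSymmetric := Matrix.isSymmetric_toEuclideanLin_iff.mpr h₁
  have hs₂ : T₂.IsSymmetric := Matrix.isSymmetric_toEuclideanLin_iff.mpr h₂
  set c := a * α.1 + b * α.2 with hc
  set S : EuclideanSpace ℂ (Fin d) →ₗ[ℂ] EuclideanSpace ℂ (Fin d) :=
    (c : ℂ) • LinearMap.id - ((a : ℂ) • T₁ + (b : ℂ) • T₂) with hS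
  have hSsym : S.IsSymmetric := (LinearMap.IsSymmetric.id.smul (by simp)).sub
    ((hs₁.smul (by simp)).add (hs₂.smul (by simp)))
  have hform : ∀ y, (⟪y, S y⟫).re
      = c * ‖y‖ ^ 2 - (a * (quadVal T₁ T₂ y).1 + b * (quadVal T₁ T₂ y).2) := by
    intro y
    simp only [hS, LinearMap.sub_apply, LinearMap.smul_apply, LinearMap.add_apply,
      LinearMap.id_apply, inner_sub_right, inner_add_right, inner_smul_right, Complex.sub_re,
      Complex.add_re, Complex.re_ofReal_mul, quadVal]
    congr 2
    rw [inner_self_eq_norm_sq_to_K]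
    norm_cast
  have hnonneg : ∀ y, 0 ≤ (⟪y, S y⟫).re := by
    intro y
    rw [hform]
    by_cases hy : ‖y‖ ^ 2 = 0
    · have : y = 0 := by simpa using hy
      simp [this, quadVal]
    · have hy' : (rankOneMatrix y).trace.re ≠ 0 := by rwa [re_trace_rankOneMatrix]
      have := hle _ ⟨_, (posSemidef_rankOneMatrix y).inv_trace_smul_mem_stateSpace hy', rfl⟩
      rw [expVal2_smul, expVal2_rankOneMatrix, re_trace_rankOneMatrix] at this
      have hpos : 0 < ‖y‖ ^ 2 := lt_of_le_of_ne (sq_nonneg _) (Ne.symm hy)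
      simp only [Prod.smul_fst, Prod.smul_snd, smul_eq_mul] at this
      field_simp at this
      have := (div_le_iff₀ hpos).mp this
      rw [← hT₁, ← hT₂] at this
      linarith
  have hx0 : (⟪x, S x⟫).re = 0 := by
    rw [hform, hx]
    simp only [Prod.smul_fst, Prod.smul_snd, smul_eq_mul, hc]
    ring
  have hzero : S x = 0 := by
    rw [← inner_self_eq_zero (𝕜 := ℂ), hSsym x]
    exact hSsym.inner_eq_zero_of_nonneg_line (fun t => hnonneg _) hx0
  have : (c : ℂ) • x - ((a : ℂ) • T₁ x + (b : ℂ) • T₂ x) = 0 := hzero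
  exact (sub_eq_zero.mp this).symm

theorem isCompact_stateSpace (d : ℕ) : IsCompact (stateSpace d) := by
  let f : EuclideanSpace ℂ (Fin d × Fin d) → Matrix (Fin d) (Fin d) ℂ :=
    fun x => (Matrix.of fun i j => x (i, j))ᴴ * Matrix.of fun i j => x (i, j)
  have hf : Continuous f := by
    refine Continuous.matrix_mul (Continuous.matrix_conjTranspose ?_) ?_ <;>
    exact continuous_matrix fun i j => by simpa using by fun_prop
  have htr : ∀ x, (f x).trace = ((‖x‖ ^ 2 : ℝ) : ℂ) := by
    intro x
    simp only [f, Matrix.trace, Matrix.diag_apply, Matrix.mul_apply, Matrix.conjTranspose_apply,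
      Matrix.of_apply, EuclideanSpace.norm_sq_eq, RCLike.star_def]
    rw [Fintype.sum_prod_type_right]
    push_cast
    simp_rw [← Complex.conj_mul']
  have : stateSpace d = f '' Metric.sphere 0 1 := by
    ext σ
    constructor
    · rintro ⟨hσ, hσ1⟩
      obtain ⟨B, rfl⟩ := hσ.exists_eq_conjTranspose_mul_self
      let x : EuclideanSpace ℂ (Fin d × Fin d) := WithLp.toLp 2 fun p => B p.1 p.2
      have hx : f x = Bᴴ * B := rfl
      refine ⟨x, ?_, hx⟩
      rw [← hx, htr] at hσ1
      rw [mem_sphere_zero_iff_norm]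
      have : ‖x‖ ^ 2 = 1 := by exact_mod_cast hσ1
      exact (pow_eq_one_iff_of_nonneg (norm_nonneg _) two_ne_zero).mp this
    · rintro ⟨x, hx, rfl⟩
      rw [mem_sphere_zero_iff_norm] at hx
      refine ⟨Matrix.posSemidef_conjTranspose_mul_self _, ?_⟩
      rw [htr, hx]
      simp
  rw [this]
  exact (isCompact_sphere _ _).image hf

theorem jointNR_subset_image_stateSpace (u₁ u₂ : Matrix (Fin d) (Fin d) ℂ) :
    jointNR u₁ u₂ ⊆ expVal2 u₁ u₂ '' stateSpace d := by
  rintro _ ⟨x, hx, rfl⟩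
  refine ⟨Matrix.vecMulVec x (star x), ⟨Matrix.posSemidef_vecMulVec_self_star x, ?_⟩, ?_⟩
  · rw [Matrix.trace_vecMulVec, dotProduct_comm, hx]
  · simp only [expVal2, Matrix.mul_vecMulVec, Matrix.trace_vecMulVec, dotProduct_comm (star x)]

theorem mapsOpenAt_of_notMem_extremePoints {u₁ u₂ ρ : Matrix (Fin d) (Fin d) ℂ}
    (hρ : ρ ∈ stateSpace d)
    (hext : expVal2 u₁ u₂ ρ ∉ (expVal2 u₁ u₂ '' stateSpace d).extremePoints ℝ) :
    MapsOpenAt (expVal2 u₁ u₂) (stateSpace d) (jointNR u₁ u₂) ρ := by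
  intro N _ hN
  refine nhdsWithin_mono _ (jointNR_subset_image_stateSpace u₁ u₂) ?_
  have hmem : ∀ᶠ σ in 𝓝 ρ, σ ∈ stateSpace d → σ ∈ N := mem_nhdsWithin_iff_eventually.mp hN
  have hshrink : ∀ᶠ ε : ℝ in 𝓝 0, ∀ σ ∈ stateSpace d,
      ρ + ε • (σ - ρ) ∈ stateSpace d → ρ + ε • (σ - ρ) ∈ N := by
    refine (isCompact_stateSpace d).eventually_forall_of_forall_eventually fun σ _ => ?_
    have hc : Continuous fun z : ℝ × Matrix (Fin d) (Fin d) ℂ => ρ + z.1 • (z.2 - ρ) := by fun_prop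
    exact (hc.tendsto' (0, σ) ρ (by simp)).eventually hmem
  obtain ⟨ε, hε, hε0, hε1⟩ := ((hshrink.filter_mono nhdsWithin_le_nhds).and
    (Ioo_mem_nhdsGT (zero_lt_one' ℝ))).exists
  filter_upwards [(convex_image_stateSpace u₁ u₂).eventually_smul_mem_of_notMem_extremePoints
    ⟨ρ, hρ, rfl⟩ hext (inv_nonneg.mpr hε0.le)] with q hq
  obtain ⟨σ, hσ, hσq⟩ := hq
  refine ⟨ρ + ε • (σ - ρ), hε σ hσ ((convex_stateSpace d).add_smul_sub_mem hρ hσ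
    ⟨hε0.le, hε1.le⟩), ?_⟩
  have : ρ + ε • (σ - ρ) = (1 - ε) • ρ + ε • σ := by module
  rw [this, expVal2_add, expVal2_smul, expVal2_smul, hσq, smul_add, smul_smul,
    mul_inv_cancel₀ hε0.ne']
  module

/-- All the summands of a state over an extreme value lie in the generating subspace. -/
theorem mem_genSubspace_of_sum_rankOneMatrix {u₁ u₂ : Matrix (Fin d) (Fin d) ℂ} {α : ℝ × ℝ}
    (hα : α ∈ (expVal2 u₁ u₂ '' stateSpace d).extremePoints ℝ)
    {y : Fin d → EuclideanSpace ℂ (Fin d)} (htr : (∑ i, rankOneMatrix (y i)).trace = 1)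
    (hE : expVal2 u₁ u₂ (∑ i, rankOneMatrix (y i)) = α) (i : Fin d) :
    y i ∈ genSubspace (isExtremeValue_of_mem_extremePoints hα) := by
  have hsum := Finset.add_sum_erase Finset.univ (fun i => rankOneMatrix (y i)) (Finset.mem_univ i)
  have := expVal2_eq_of_add hα (posSemidef_rankOneMatrix (y i))
    (Matrix.posSemidef_sum (Finset.univ.erase i) fun j _ => posSemidef_rankOneMatrix (y j))
    (by rw [hsum, htr, hE, Complex.one_re, one_smul])
  rwa [expVal2_rankOneMatrix, re_trace_rankOneMatrix] at this

theorem eq_of_finrank_genSubspace_le_one {u₁ u₂ ρ σ : Matrix (Fin d) (Fin d) ℂ} {α : ℝ × ℝ}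
    (hα : α ∈ (expVal2 u₁ u₂ '' stateSpace d).extremePoints ℝ)
    (hfin : Module.finrank ℂ (genSubspace (isExtremeValue_of_mem_extremePoints hα)) ≤ 1)
    (hρ : ρ ∈ stateSpace d) (hσ : σ ∈ stateSpace d) (hρα : expVal2 u₁ u₂ ρ = α)
    (hσα : expVal2 u₁ u₂ σ = α) : ρ = σ := by
  obtain ⟨⟨x, hx⟩, hspan⟩ := finrank_le_one_iff.mp hfin
  have key : ∀ τ ∈ stateSpace d, expVal2 u₁ u₂ τ = α → τ = (‖x‖ ^ 2)⁻¹ • rankOneMatrix x := by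
    rintro τ ⟨hτ, hτ1⟩ hτα
    obtain ⟨y, rfl⟩ := hτ.exists_eq_sum_rankOneMatrix
    have hy : ∀ i, ∃ r : ℝ, rankOneMatrix (y i) = r • rankOneMatrix x := by
      intro i
      obtain ⟨c, hc⟩ := hspan ⟨y i, mem_genSubspace_of_sum_rankOneMatrix hα hτ1 hτα i⟩
      refine ⟨‖c‖ ^ 2, ?_⟩
      rw [← rankOneMatrix_smul, show c • x = y i from congrArg Subtype.val hc]
    choose r hr using hy
    simp_rw [hr, ← Finset.sum_smul] at hτ1 ⊢
    have h := congrArg Complex.re hτ1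
    rw [trace_smul, Complex.smul_re, re_trace_rankOneMatrix, smul_eq_mul, Complex.one_re] at h
    rw [eq_inv_of_mul_eq_one_left h]
  rw [key ρ hρ hρα, key σ hσ hσα]

theorem mapsOpenAt_of_fiber_eq {u₁ u₂ ρ : Matrix (Fin d) (Fin d) ℂ}
    (h : ∀ σ ∈ stateSpace d, expVal2 u₁ u₂ σ = expVal2 u₁ u₂ ρ → σ = ρ) :
    MapsOpenAt (expVal2 u₁ u₂) (stateSpace d) (jointNR u₁ u₂) ρ := by
  intro N _ hN
  obtain ⟨U, hU, hρU, hUN⟩ := mem_nhdsWithin.mp hN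
  have hclosed : IsClosed (expVal2 u₁ u₂ '' (stateSpace d \ U)) :=
    (((isCompact_stateSpace d).diff hU).image (continuous_expVal2 u₁ u₂)).isClosed
  have hnot : expVal2 u₁ u₂ ρ ∉ expVal2 u₁ u₂ '' (stateSpace d \ U) := by
    rintro ⟨σ, ⟨hσ, hσU⟩, hσρ⟩
    exact hσU (h σ hσ hσρ ▸ hρU)
  refine mem_nhdsWithin.mpr ⟨_, hclosed.isOpen_compl, hnot, ?_⟩
  rintro q ⟨hq, hqW⟩
  obtain ⟨σ, hσ, rfl⟩ := jointNR_subset_image_stateSpace u₁ u₂ hqW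
  exact ⟨σ, hUN ⟨by_contra fun hσU => hq ⟨σ, ⟨hσ, hσU⟩, rfl⟩, hσ⟩, rfl⟩

theorem exists_two_le_finrank_genSubspace {u₁ u₂ ρ : Matrix (Fin d) (Fin d) ℂ}
    (hρ : ρ ∈ stateSpace d)
    (hopen : ¬ MapsOpenAt (expVal2 u₁ u₂) (stateSpace d) (jointNR u₁ u₂) ρ) :
    ∃ hα : expVal2 u₁ u₂ ρ ∈ (expVal2 u₁ u₂ '' stateSpace d).extremePoints ℝ,
      2 ≤ Module.finrank ℂ (genSubspace (isExtremeValue_of_mem_extremePoints hα)) := by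
  have hα : expVal2 u₁ u₂ ρ ∈ (expVal2 u₁ u₂ '' stateSpace d).extremePoints ℝ :=
    by_contra fun h => hopen (mapsOpenAt_of_notMem_extremePoints hρ h)
  refine ⟨hα, by_contra fun h => hopen (mapsOpenAt_of_fiber_eq fun σ hσ hσρ => ?_)⟩
  exact eq_of_finrank_genSubspace_le_one hα (by omega) hσ hρ hσρ rfl

end AbstractForms

theorem Set.finite_and_ncard_le_two {X : Type*} {s : Set X}
    (h : ∀ a ∈ s, ∀ b ∈ s, ∀ c ∈ s, a ≠ b → a ≠ c → b ≠ c → False) :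
    s.Finite ∧ s.ncard ≤ 2 := by
  have : s.encard ≤ 2 := by
    by_contra! hlt
    obtain ⟨t, hts, ht⟩ := Set.exists_subset_encard_eq (Order.add_one_le_of_lt hlt)
    obtain ⟨a, b, c, hab, hac, hbc, rfl⟩ := Set.encard_eq_three.mp (ht.trans (by norm_num))
    exact h a (hts (by simp)) b (hts (by simp)) c (hts (by simp)) hab hac hbc
  exact Set.encard_le_coe_iff_finite_ncard_le.mp this

theorem at_most_d_sub_three_nonopen_points {d : ℕ}
    (hd1 : 1 ≤ d) (hd5 : d ≤ 5)
    (u₁ u₂ : Matrix (Fin d) (Fin d) ℂ)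
    (h₁ : u₁.IsHermitian) (h₂ : u₂.IsHermitian)
    (hirr : ¬ UnitarilyReducible (u₁ + Complex.I • u₂)) :
    {α ∈ jointNR u₁ u₂ | ∃ ρ ∈ stateSpace d, expVal2 u₁ u₂ ρ = α ∧
        ¬ MapsOpenAt (expVal2 u₁ u₂) (stateSpace d) (jointNR u₁ u₂) ρ}.Finite ∧
    {α ∈ jointNR u₁ u₂ | ∃ ρ ∈ stateSpace d, expVal2 u₁ u₂ ρ = α ∧
        ¬ MapsOpenAt (expVal2 u₁ u₂) (stateSpace d) (jointNR u₁ u₂) ρ}.ncard ≤ d - 3 := by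
  set s := {α ∈ jointNR u₁ u₂ | ∃ ρ ∈ stateSpace d, expVal2 u₁ u₂ ρ = α ∧
    ¬ MapsOpenAt (expVal2 u₁ u₂) (stateSpace d) (jointNR u₁ u₂) ρ}
  have hs₁ : (Matrix.toEuclideanLin u₁).IsSymmetric := Matrix.isSymmetric_toEuclideanLin_iff.mpr h₁
  have hs₂ : (Matrix.toEuclideanLin u₂).IsSymmetric := Matrix.isSymmetric_toEuclideanLin_iff.mpr h₂
  have hpair := isIrreduciblePair_of_not_unitarilyReducible h₁ h₂ hirr
  have hE : Module.finrank ℂ (EuclideanSpace ℂ (Fin d)) = d := finrank_euclideanSpace_fin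
  have hs : ∀ α ∈ s, ∃ hα : α ∈ (expVal2 u₁ u₂ '' stateSpace d).extremePoints ℝ,
      2 ≤ Module.finrank ℂ (genSubspace (isExtremeValue_of_mem_extremePoints hα)) := by
    rintro _ ⟨-, ρ, hρ, rfl, hopen⟩
    exact exists_two_le_finrank_genSubspace hρ hopen
  have hd4 : ∀ α ∈ s, 4 ≤ d := by
    intro α hα
    obtain ⟨hext, hL⟩ := hs α hα
    obtain ⟨a, b, hsupp⟩ := exists_hasSupport_of_mem_extremePoints h₁ h₂ hext
    have h2 : 2 ≤ Module.finrank ℂ (EuclideanSpace ℂ (Fin d)) :=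
      hL.trans (Submodule.finrank_le _)
    have := two_mul_finrank_genSubspace_le hs₁ hs₂ hpair h2
      (isExtremeValue_of_mem_extremePoints hext) hsupp
    omega
  rcases (by omega : d ≤ 3 ∨ d = 4 ∨ d = 5) with hd | hd | hd
  · have : s = ∅ := Set.eq_empty_of_forall_notMem fun α hα => by have := hd4 α hα; omega
    simp [this]
  · have hsub : s.Subsingleton := by
      intro α hα β hβ
      by_contra hne
      obtain ⟨hαe, hLα⟩ := hs α hα
      obtain ⟨hβe, hLβ⟩ := hs β hβ
      obtain ⟨_, _, hsα⟩ := exists_hasSupport_of_mem_extremePoints h₁ h₂ hαe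
      obtain ⟨_, _, hsβ⟩ := exists_hasSupport_of_mem_extremePoints h₁ h₂ hβe
      exact not_two_extremeValues_of_finrank_eq_four hs₁ hs₂ hpair (hE.trans hd) _ _ hne hsα hsβ
        hLα hLβ
    exact ⟨hsub.finite, ((Set.ncard_le_one hsub.finite).mpr fun _ ha _ hb => hsub ha hb).trans (by omega)⟩
  · refine (Set.finite_and_ncard_le_two ?_).imp_right fun h => h.trans (by omega)
    intro α hα β hβ γ hγ hαβ hαγ hβγ
    obtain ⟨hαe, hLα⟩ := hs α hα
    obtain ⟨hβe, hLβ⟩ := hs β hβ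
    obtain ⟨hγe, hLγ⟩ := hs γ hγ
    obtain ⟨_, _, hsα⟩ := exists_hasSupport_of_mem_extremePoints h₁ h₂ hαe
    obtain ⟨_, _, hsβ⟩ := exists_hasSupport_of_mem_extremePoints h₁ h₂ hβe
    obtain ⟨_, _, hsγ⟩ := exists_hasSupport_of_mem_extremePoints h₁ h₂ hγe
    exact not_three_extremeValues_of_finrank_eq_five hs₁ hs₂ hpair (hE.trans hd) _ _ _ hαβ hαγ hβγ
      hsα hsβ hsγ hLα hLβ hLγ
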